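/- Let ℒ := {3, 7, 11, 15, 19, 35, 43, 51, 67, 91, 115, 123, 163, 187, 235, 267, 403, 427}. Let d ∈ ℒ and let r ≥ 3 be any prime such that p ≢ 1 (mod r) for all primes p dividing d. Then the set of positive integers k that can be written as k = n₁² + d n₂² + n₃^r for some n₁, n₂, n₃ ∈ ℤ has natural density 1; that is, lim_{N→∞} (1/N) · #{ 1 ≤ k ≤ N : ∃ n₁, n₂, n₃ ∈ ℤ, k = n₁² + d n₂² + n₃^r } = 1. -/

import Mathlib

lemma card_le_of_pairwise_dvd_sub (s : Finset ℤ) (a m : ℤ) (K : ℕ) (hm : 0 < m)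
    (hs : ∀ x ∈ s, a ≤ x ∧ x < a + K * m) (h : ∀ x ∈ s, ∀ y ∈ s, m ∣ x - y) :
    s.card ≤ K := by
  have key : s.card ≤ (Finset.Ico (0 : ℤ) K).card := by
    refine Finset.card_le_card_of_injOn (fun x => (x - a) / m) ?_ ?_
    · intro x hx
      obtain ⟨h1, h2⟩ := hs x hx
      simp only [Finset.coe_Ico, Set.mem_Ico]
      exact ⟨Int.ediv_nonneg (by linarith) hm.le,
        Int.ediv_lt_of_lt_mul hm (by linarith)⟩
    · intro x hx y hy hxy
      obtain ⟨k, hk⟩ := h x hx y hy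
      have h3 : x - a = (y - a) + m * k := by linarith
      simp only [h3, Int.add_mul_ediv_left _ _ hm.ne'] at hxy
      have : k = 0 := by linarith
      subst this
      linarith
  simpa using key

lemma exists_mul_coprime_part (q t : ℕ) (ht : 0 < t) :
    ∃ u v : ℕ, t = u * v ∧ v.Coprime q ∧ ∀ p : ℕ, p.Prime → p ∣ u → p ∣ q := by
  induction t using Nat.strong_induction_on with
  | _ t ih =>
    by_cases hc : t.Coprime q
    · exact ⟨1, t, by simp, hc, fun p hp h => absurd (Nat.dvd_one.mp h) hp.ne_one⟩
    · obtain ⟨p, hp, hpt, hpq⟩ := Nat.Prime.not_coprime_iff_dvd.mp hc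
      obtain ⟨t', rfl⟩ := hpt
      have ht' : 0 < t' := Nat.pos_of_mul_pos_left ht
      obtain ⟨u, v, h1, h2, h3⟩ := ih t' (lt_mul_of_one_lt_left ht' hp.one_lt) ht'
      refine ⟨p * u, v, by rw [h1]; ring, h2, fun l hl h => ?_⟩
      rcases hl.dvd_mul.mp h with h | h
      · rwa [(Nat.prime_dvd_prime_iff_eq hl hp).mp h]
      · exact h3 l hl h

lemma isCoprime_of_forall_prime_dvd {w : ℤ} {q a : ℕ} (hw : IsCoprime w (q : ℤ))
    (h : ∀ p : ℕ, p.Prime → p ∣ a → p ∣ q) : IsCoprime w (a : ℤ) := by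
  rw [Int.isCoprime_iff_gcd_eq_one] at hw ⊢
  by_contra hne
  obtain ⟨p, hp, hpd⟩ := Nat.exists_prime_and_dvd hne
  have h1 : (p : ℤ) ∣ w := (Int.natCast_dvd_natCast.mpr hpd).trans (Int.gcd_dvd_left ..)
  have h2 : p ∣ a := Int.natCast_dvd_natCast.mp
    ((Int.natCast_dvd_natCast.mpr hpd).trans (Int.gcd_dvd_right ..))
  have h3 : (p : ℤ) ∣ (Int.gcd w q : ℤ) :=
    Int.dvd_coe_gcd h1 (Int.natCast_dvd_natCast.mpr (h p hp h2))
  rw [hw] at h3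
  exact hp.one_lt.ne' (Nat.dvd_one.mp (by exact_mod_cast h3))

lemma card_bilinear_congruence_le (q v n₁ L : ℕ) (hv : 0 < v) (hq : v.Coprime (2 * q))
    (y₀ c b : ℤ) :
    ((Finset.Ico (0 : ℤ) v ×ˢ Finset.Ico b (b + (L * (n₁ * v) : ℕ))).filter
      (fun z => (v : ℤ) ∣ z.1 * (y₀ + q * z.1 + 2 * q * z.2) + c)).card
      ≤ L * (n₁ * v) * (v.divisors.filter (fun g : ℕ => (g : ℤ) ∣ c)).card := by
  classical
  set T := (Finset.Ico (0 : ℤ) v ×ˢ Finset.Ico b (b + (L * (n₁ * v) : ℕ))).filter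
      (fun z => (v : ℤ) ∣ z.1 * (y₀ + q * z.1 + 2 * q * z.2) + c) with hT
  refine Finset.card_le_mul_card_image_of_maps_to (f := fun z : ℤ × ℤ => Int.gcd z.1 v) ?_ _ ?_
  · intro z hz
    rw [hT, Finset.mem_filter] at hz
    rw [Finset.mem_filter, Nat.mem_divisors]
    have h1 : (Int.gcd z.1 v : ℤ) ∣ v := Int.gcd_dvd_right ..
    have h2 : (Int.gcd z.1 v : ℤ) ∣ z.1 := Int.gcd_dvd_left ..
    exact ⟨⟨Int.natCast_dvd_natCast.mp h1, hv.ne'⟩,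
      (dvd_add_right (h2.mul_right _)).mp (h1.trans hz.2)⟩
  · intro g hg
    rw [Finset.mem_filter, Nat.mem_divisors] at hg
    obtain ⟨⟨⟨v', hv'⟩, -⟩, -⟩ := hg
    have hg0 : 0 < g := by rcases Nat.eq_zero_or_pos g with h | h <;> simp_all
    have hv0 : 0 < v' := by rcases Nat.eq_zero_or_pos v' with h | h <;> simp_all
    have hS : ((Finset.Ico (0 : ℤ) v).filter (fun x => (g : ℤ) ∣ x)).card ≤ v' := by
      refine card_le_of_pairwise_dvd_sub _ 0 g v' (by exact_mod_cast hg0) ?_ ?_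
      · intro x hx
        simp only [Finset.mem_filter, Finset.mem_Ico] at hx
        refine ⟨hx.1.1, ?_⟩
        have : (v : ℤ) = g * v' := by exact_mod_cast hv'
        linarith [hx.1.2]
      · intro x hx y hy
        exact dvd_sub (Finset.mem_filter.mp hx).2 (Finset.mem_filter.mp hy).2
    have hF : (T.filter (fun z => Int.gcd z.1 v = g)).card ≤ (L * n₁ * g) *
        ((Finset.Ico (0 : ℤ) v).filter (fun x => (g : ℤ) ∣ x)).card := by
      refine Finset.card_le_mul_card_image_of_maps_to (f := Prod.fst) ?_ _ ?_
      · intro z hz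
        simp only [hT, Finset.mem_filter, Finset.mem_product] at hz ⊢
        refine ⟨hz.1.1.1, ?_⟩
        rw [← hz.2]
        exact Int.gcd_dvd_left ..
      · intro σ _
        rw [← Finset.card_image_of_injOn (f := Prod.snd)]
        · refine card_le_of_pairwise_dvd_sub _ b v' _ (by exact_mod_cast hv0) ?_ ?_
          · intro x hx
            simp only [hT, Finset.mem_image, Finset.mem_filter, Finset.mem_product,
              Finset.mem_Ico] at hx
            obtain ⟨z, ⟨⟨⟨⟨-, h⟩, -⟩, -⟩, -⟩, rfl⟩ := hx
            refine ⟨h.1, ?_⟩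
            have h2 := h.2
            rw [hv'] at h2
            push_cast at h2 ⊢
            linarith
          · intro x hx y hy
            simp only [Finset.mem_image, Finset.mem_filter, hT] at hx hy
            obtain ⟨z, ⟨⟨⟨-, hz⟩, hzg⟩, rfl⟩, rfl⟩ := hx
            obtain ⟨z', ⟨⟨⟨-, hz'⟩, -⟩, hzz⟩, rfl⟩ := hy
            have h1 : (v : ℤ) ∣ (2 * q : ℕ) * (z.1 * (z.2 - z'.2)) := by
              obtain ⟨k, hk⟩ := hz
              obtain ⟨k', hk'⟩ := hz'
              rw [hzz] at hk'
              refine ⟨k - k', ?_⟩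
              push_cast
              linear_combination hk - hk'
            have h2 : (v : ℤ) ∣ z.1 * (z.2 - z'.2) :=
              IsCoprime.dvd_of_dvd_mul_left (Nat.isCoprime_iff_coprime.mpr hq) h1
            obtain ⟨w, hw⟩ : (g : ℤ) ∣ z.1 := by rw [← hzg]; exact Int.gcd_dvd_left ..
            have hcop : IsCoprime (v' : ℤ) w := by
              rw [Int.isCoprime_iff_gcd_eq_one]
              have h3 : Int.gcd (g * w) (g * v') = g := by
                rw [← hw]; rw [hv'] at hzg; exact_mod_cast hzg
              rw [Int.gcd_mul_left] at h3
              simp only [Int.natAbs_natCast] at h3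
              rw [Int.gcd_comm]
              exact Nat.eq_of_mul_eq_mul_left hg0 (by linarith)
            have h4 : (v' : ℤ) ∣ w * (z.2 - z'.2) := by
              rw [hw, hv'] at h2
              push_cast at h2
              rw [mul_assoc] at h2
              exact (mul_dvd_mul_iff_left (by exact_mod_cast hg0.ne')).mp h2
            exact hcop.dvd_of_dvd_mul_left h4
        · intro z hz z' hz' h
          simp only [Finset.coe_filter, Set.mem_ofPred_eq] at hz hz'
          exact Prod.ext (hz.2.trans hz'.2.symm) h
    calc _ ≤ _ := hF
      _ ≤ (L * n₁ * g) * v' := Nat.mul_le_mul_left _ hS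
      _ = L * (n₁ * v) := by rw [hv']; ring

lemma card_congruence_le (q d t : ℕ) (hq : 0 < q) (hd : 0 < d) (ht : 0 < t)
    (h2q : 2 ∣ q) (hdq : ∀ p : ℕ, p.Prime → p ∣ d → p ∣ q)
    (y₀ c e a b : ℤ) (hy : IsCoprime y₀ (q : ℤ)) (K L : ℕ) :
    ((Finset.Ico a (a + K * (2 * q * d * t : ℕ)) ×ˢ
        Finset.Ico b (b + L * (2 * q * d * t : ℕ))).filter
      (fun z => ((2 * q * d * t : ℕ) : ℤ) ∣
        z.1 * (y₀ + q * z.1 + 2 * q * z.2) + c - t * e)).card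
      ≤ K * (L * (2 * q * d * t) *
        (t.divisors.filter (fun g : ℕ => (g : ℤ) ∣ c ∧ g.Coprime q)).card) := by
  classical
  obtain ⟨u, v, htuv, hvq, hu⟩ := exists_mul_coprime_part q t ht
  have hv : 0 < v := by rcases Nat.eq_zero_or_pos v with h | h <;> simp_all
  set n₁ := 2 * q * d * u with hn₁
  have hn : 2 * q * d * t = n₁ * v := by rw [htuv, hn₁]; ring
  have hn₁q : ∀ p : ℕ, p.Prime → p ∣ n₁ → p ∣ q := by
    intro p hp h
    rcases hp.dvd_mul.mp h with h | h
    · rcases hp.dvd_mul.mp h with h | h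
      · rcases hp.dvd_mul.mp h with h | h
        · exact h.trans h2q
        · exact h
      · exact hdq p hp h
    · exact hu p hp h
  have hvn₁ : IsCoprime (v : ℤ) (n₁ : ℤ) :=
    isCoprime_of_forall_prime_dvd (Nat.isCoprime_iff_coprime.mpr hvq) hn₁q
  have hv2q : v.Coprime (2 * q) := by
    have : IsCoprime (v : ℤ) ((2 * q : ℕ) : ℤ) := by
      refine isCoprime_of_forall_prime_dvd (Nat.isCoprime_iff_coprime.mpr hvq) ?_
      intro p hp h
      rcases hp.dvd_mul.mp h with h | h
      · exact h.trans h2q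
      · exact h
    exact Nat.isCoprime_iff_coprime.mp this
  have hvt : (v : ℤ) ∣ (t : ℤ) := by rw [htuv]; push_cast; exact dvd_mul_left _ _
  rw [hn]
  have hG : (v.divisors.filter (fun g : ℕ => (g : ℤ) ∣ c)).card ≤
      (t.divisors.filter (fun g : ℕ => (g : ℤ) ∣ c ∧ g.Coprime q)).card := by
    refine Finset.card_le_card fun g hg => ?_
    simp only [Finset.mem_filter, Nat.mem_divisors] at hg ⊢
    exact ⟨⟨hg.1.1.trans (by rw [htuv]; exact dvd_mul_left _ _), ht.ne'⟩, hg.2,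
      Nat.Coprime.coprime_dvd_left hg.1.1 hvq⟩
  have hT := card_bilinear_congruence_le q v n₁ L hv hv2q y₀ c b
  refine le_trans ?_ (Nat.mul_le_mul_left K (hT.trans (Nat.mul_le_mul_left _ hG)))
  refine Finset.card_le_mul_card_image_of_maps_to (f := fun z : ℤ × ℤ => (z.1 % (v : ℤ), z.2)) ?_ _ ?_
  · intro z hz
    simp only [Finset.mem_filter, Finset.mem_product, Finset.mem_Ico] at hz ⊢
    have hv' : (0 : ℤ) < v := by exact_mod_cast hv
    refine ⟨⟨⟨Int.emod_nonneg _ hv'.ne', Int.emod_lt_of_pos _ hv'⟩, ?_⟩, ?_⟩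
    · refine ⟨hz.1.2.1, ?_⟩
      have := hz.1.2.2
      push_cast at this ⊢
      exact this
    · have h1 : (v : ℤ) ∣ z.1 * (y₀ + q * z.1 + 2 * q * z.2) + c := by
        have h2 : (v : ℤ) ∣ z.1 * (y₀ + q * z.1 + 2 * q * z.2) + c - t * e :=
          Dvd.dvd.trans (by push_cast; exact dvd_mul_left _ _) hz.2
        have h3 := dvd_add h2 (hvt.mul_right e)
        simpa using h3
      have h4 : z.1 % v = z.1 - v * (z.1 / v) := Int.emod_def _ _
      rw [h4]
      obtain ⟨k, hk⟩ := h1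
      refine ⟨k - (z.1 / v) * (y₀ + q * z.1 + 2 * q * z.2)
        - q * (z.1 - v * (z.1 / v)) * (z.1 / v), ?_⟩
      linear_combination hk
  · intro σ _
    rw [← Finset.card_image_of_injOn (f := Prod.fst)]
    · refine card_le_of_pairwise_dvd_sub _ a ((n₁ * v : ℕ) : ℤ) K ?_ ?_ ?_
      · have : 0 < n₁ * v := by rw [← hn]; positivity
        exact_mod_cast this
      · intro x hx
        simp only [Finset.mem_image, Finset.mem_filter, Finset.mem_product,
          Finset.mem_Ico] at hx
        obtain ⟨z, ⟨⟨⟨h, -⟩, -⟩, -⟩, rfl⟩ := hx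
        exact h
      · intro x hx y hy'
        simp only [Finset.mem_image, Finset.mem_filter] at hx hy'
        obtain ⟨z, ⟨⟨-, hz⟩, hzσ⟩, rfl⟩ := hx
        obtain ⟨z', ⟨⟨-, hz'⟩, hzσ'⟩, rfl⟩ := hy'
        rw [← hzσ, Prod.mk.injEq] at hzσ'
        obtain ⟨h1, h2⟩ := hzσ'
        have hdv : (v : ℤ) ∣ z.1 - z'.1 := Int.ModEq.dvd h1
        have hdn : (n₁ : ℤ) ∣ z.1 - z'.1 := by
          have h3 : ((n₁ * v : ℕ) : ℤ) ∣
              (y₀ + q * (z.1 + z'.1 + 2 * z.2)) * (z.1 - z'.1) := by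
            obtain ⟨k, hk⟩ := hz
            obtain ⟨k', hk'⟩ := hz'
            rw [h2] at hk'
            exact ⟨k - k', by linear_combination hk - hk'⟩
          have h4 : (n₁ : ℤ) ∣ (y₀ + q * (z.1 + z'.1 + 2 * z.2)) * (z.1 - z'.1) :=
            Dvd.dvd.trans (by push_cast; exact dvd_mul_right _ _) h3
          have h5 : IsCoprime (y₀ + q * (z.1 + z'.1 + 2 * z.2)) (n₁ : ℤ) :=
            isCoprime_of_forall_prime_dvd (hy.add_mul_left_left _) hn₁q
          exact h5.symm.dvd_of_dvd_mul_left h4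
        push_cast
        exact hvn₁.symm.mul_dvd hdn hdv
    · intro z hz z' hz' h
      simp only [Finset.coe_filter, Set.mem_ofPred_eq] at hz hz'
      have h1 := hz.2.trans hz'.2.symm
      simp only [Prod.mk.injEq] at h1
      exact Prod.ext h h1.2

/-- The solutions of `A(ξ) + B(η) = A(ξ') + B(η') + c`, where `A(ξ) = x₀ξ + qdξ²` and
`B(η) = y₀η + qη²`, with `ξ, ξ'` and `η, η'` in the intervals adapted to `κ` and `P`. -/
noncomputable def collisions (q d κ P : ℕ) (x₀ y₀ c : ℤ) : Finset ((ℤ × ℤ) × (ℤ × ℤ)) :=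
  ((Finset.Ico (2 * q * κ ^ 4 * P : ℤ) (2 * q * κ ^ 4 * P + 2 * q * κ ^ 3 * P) ×ˢ
    Finset.Ico (2 * q * κ ^ 4 * P : ℤ) (2 * q * κ ^ 4 * P + 2 * q * κ ^ 3 * P)) ×ˢ
    (Finset.Ico (κ ^ 2 * P : ℤ) (κ ^ 2 * P + P) ×ˢ
      Finset.Ico (κ ^ 2 * P : ℤ) (κ ^ 2 * P + P))).filter
    (fun z => x₀ * z.1.1 + q * d * z.1.1 ^ 2 + (y₀ * z.2.1 + q * z.2.1 ^ 2)
      = x₀ * z.1.2 + q * d * z.1.2 ^ 2 + (y₀ * z.2.2 + q * z.2.2 ^ 2) + c)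

lemma sub_bounds_of_collision {q d κ P t s v w c : ℤ} (hq : 0 < q) (hd : 0 < d) (hκ : 2 ≤ κ)
    (hP : 0 < P) (ht : 0 < t) (hc : |c| ≤ P) (h : t * v = s * w + c)
    (hv : 4 * q ^ 2 * d * κ ^ 4 * P ≤ v)
    (hv' : v ≤ 4 * q ^ 2 * d * κ ^ 3 * (κ + 1) * P)
    (hw : 2 * q * κ ^ 2 * P ≤ w) (hw' : w ≤ 2 * q * (κ ^ 2 + 2) * P) :
    (κ ^ 2 - 2) * (2 * q * d * t) ≤ s ∧ s < (κ ^ 2 + κ + 2) * (2 * q * d * t) := by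
  have hκ0 : 0 < κ := by linarith
  obtain ⟨hc1, hc2⟩ := abs_le.mp hc
  have hw0 : 0 < w := lt_of_lt_of_le (by positivity) hw
  have hqdt : 1 ≤ q * d * t := by
    have : 0 < q * d * t := by positivity
    linarith
  have h1 : t * (4 * q ^ 2 * d * κ ^ 4 * P) ≤ t * v := mul_le_mul_of_nonneg_left hv ht.le
  have h2 : t * v ≤ t * (4 * q ^ 2 * d * κ ^ 3 * (κ + 1) * P) :=
    mul_le_mul_of_nonneg_left hv' ht.le
  have hPle : P ≤ 4 * q * P * (q * d * t) := by
    have : 0 ≤ (4 * q * P) * (q * d * t - 1) := mul_nonneg (by positivity) (by linarith)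
    nlinarith
  have hs : 0 < s := by
    by_contra hs
    have h3 : s * w ≤ 0 := mul_nonpos_of_nonpos_of_nonneg (by linarith) hw0.le
    have h4 : 1 < κ ^ 4 := by nlinarith [pow_pos hκ0 3, pow_pos hκ0 2]
    have h5 : 4 * q * P * (q * d * t) < κ ^ 4 * (4 * q * P * (q * d * t)) :=
      lt_mul_of_one_lt_left (by positivity) h4
    nlinarith
  constructor
  · by_contra hlt
    push Not at hlt
    have h3 : s * w ≤ s * (2 * q * (κ ^ 2 + 2) * P) := mul_le_mul_of_nonneg_left hw' hs.le
    have h4 : s * (2 * q * (κ ^ 2 + 2) * P) <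
        (κ ^ 2 - 2) * (2 * q * d * t) * (2 * q * (κ ^ 2 + 2) * P) :=
      mul_lt_mul_of_pos_right hlt (by positivity)
    nlinarith
  · have h3 : s * (2 * q * κ ^ 2 * P) ≤ s * w := mul_le_mul_of_nonneg_left hw hs.le
    by_contra hlt
    push Not at hlt
    have h4 : (κ ^ 2 + κ + 2) * (2 * q * d * t) * (2 * q * κ ^ 2 * P) ≤
      s * (2 * q * κ ^ 2 * P) := mul_le_mul_of_nonneg_right hlt (by positivity)
    have h5 : 1 < κ ^ 2 := by nlinarith
    have h6 : 4 * q * P * (q * d * t) < κ ^ 2 * (4 * q * P * (q * d * t)) :=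
      lt_mul_of_one_lt_left (by positivity) h5
    nlinarith

lemma exists_of_mem_collisions {q d κ P : ℕ} (hq : 0 < q) (hd : 0 < d) (hκ : 2 ≤ κ)
    (hP : 0 < P) {x₀ y₀ c : ℤ} (hx₀ : 0 ≤ x₀) (hx₀' : x₀ ≤ 2 * q * d) (hy₀ : 0 ≤ y₀)
    (hy₀' : y₀ ≤ 2 * q) (hc : |c| ≤ P) {z : (ℤ × ℤ) × (ℤ × ℤ)}
    (hz : z ∈ collisions q d κ P x₀ y₀ c) (hlt : z.1.2 < z.1.1) :
    ∃ t s : ℤ, t = z.1.1 - z.1.2 ∧ s = z.2.2 - z.2.1 ∧ 0 < t ∧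
      t * (x₀ + q * d * t + 2 * q * d * z.1.2) = s * (y₀ + q * s + 2 * q * z.2.1) + c ∧
      ((κ : ℤ) ^ 2 - 2) * (2 * q * d * t) ≤ s ∧
      s < ((κ : ℤ) ^ 2 + κ + 2) * (2 * q * d * t) ∧
      (κ ^ 2 * P : ℤ) ≤ z.2.1 ∧ z.2.1 + s < κ ^ 2 * P + P := by
  have hqZ : (0 : ℤ) < q := by exact_mod_cast hq
  have hdZ : (0 : ℤ) < d := by exact_mod_cast hd
  have hκZ : (2 : ℤ) ≤ κ := by exact_mod_cast hκ
  have hPZ : (0 : ℤ) < P := by exact_mod_cast hP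
  simp only [collisions, Finset.mem_filter, Finset.mem_product, Finset.mem_Ico] at hz
  obtain ⟨⟨⟨⟨hξ1, hξ2⟩, hξ3, hξ4⟩, ⟨hη1, hη2⟩, hη3, hη4⟩, heq⟩ := hz
  have he : (z.1.1 - z.1.2) * (x₀ + q * d * (z.1.1 + z.1.2)) =
      (z.2.2 - z.2.1) * (y₀ + q * (z.2.1 + z.2.2)) + c := by linear_combination heq
  have hqd : (0 : ℤ) < q * d := by positivity
  have hb := sub_bounds_of_collision (c := c) hqZ hdZ hκZ hPZ
    (show 0 < z.1.1 - z.1.2 by linarith) hc he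
    (by nlinarith [mul_le_mul_of_nonneg_left hξ1 hqd.le,
          mul_le_mul_of_nonneg_left hξ3 hqd.le])
    (by nlinarith [mul_le_mul_of_nonneg_left (show z.1.1 + 1 ≤ _ from hξ2) hqd.le,
          mul_le_mul_of_nonneg_left (show z.1.2 + 1 ≤ _ from hξ4) hqd.le])
    (by nlinarith [mul_le_mul_of_nonneg_left hη1 hqZ.le,
          mul_le_mul_of_nonneg_left hη3 hqZ.le])
    (by nlinarith [mul_le_mul_of_nonneg_left (show z.2.1 + 1 ≤ _ from hη2) hqZ.le,
          mul_le_mul_of_nonneg_left (show z.2.2 + 1 ≤ _ from hη4) hqZ.le,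
          mul_nonneg hqZ.le hPZ.le])
  exact ⟨_, _, rfl, rfl, by linarith, by linear_combination he, hb.1, hb.2, hη1, by linarith⟩

set_option maxHeartbeats 800000 in
lemma card_collisions_gt_le (q d κ P : ℕ) (hq : 0 < q) (hd : 0 < d) (hκ : 2 ≤ κ) (hP : 0 < P)
    (h2q : 2 ∣ q) (hdq : ∀ p : ℕ, p.Prime → p ∣ d → p ∣ q) (x₀ y₀ c : ℤ)
    (hx₀ : 0 ≤ x₀) (hx₀' : x₀ ≤ 2 * q * d) (hy₀ : 0 ≤ y₀) (hy₀' : y₀ ≤ 2 * q)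
    (hy : IsCoprime y₀ (q : ℤ)) (hc : |c| ≤ P) :
    ((collisions q d κ P x₀ y₀ c).filter (fun z => z.1.2 < z.1.1)).card ≤
      ∑ t ∈ Finset.Icc 1 P, (κ + 4) * ((P - (κ ^ 2 - 3) * (2 * q * d) * t) *
        (t.divisors.filter (fun g : ℕ => (g : ℤ) ∣ c ∧ g.Coprime q)).card) := by
  classical
  have hqZ : (0 : ℤ) < q := by exact_mod_cast hq
  have hdZ : (0 : ℤ) < d := by exact_mod_cast hd
  have hκZ : (2 : ℤ) ≤ κ := by exact_mod_cast hκ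
  have hPZ : (0 : ℤ) < P := by exact_mod_cast hP
  set F := (collisions q d κ P x₀ y₀ c).filter (fun z => z.1.2 < z.1.1) with hF
  have key : ∀ z ∈ F, ∃ t s : ℤ, t = z.1.1 - z.1.2 ∧ s = z.2.2 - z.2.1 ∧ 0 < t ∧
      t * (x₀ + q * d * t + 2 * q * d * z.1.2) = s * (y₀ + q * s + 2 * q * z.2.1) + c ∧
      ((κ : ℤ) ^ 2 - 2) * (2 * q * d * t) ≤ s ∧
      s < ((κ : ℤ) ^ 2 + κ + 2) * (2 * q * d * t) ∧
      (κ ^ 2 * P : ℤ) ≤ z.2.1 ∧ z.2.1 + s < κ ^ 2 * P + P := by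
    intro z hz
    rw [hF, Finset.mem_filter] at hz
    exact exists_of_mem_collisions hq hd hκ hP hx₀ hx₀' hy₀ hy₀' hc hz.1 hz.2
  have hlam : (2 : ℤ) ≤ (κ : ℤ) ^ 2 - 2 := by nlinarith
  have hsmall : ∀ t s : ℤ, 0 < t → ((κ : ℤ) ^ 2 - 2) * (2 * q * d * t) ≤ s → t ≤ s := by
    intro t s ht h
    have h1 : 1 ≤ (q : ℤ) * d := by
      have : (0 : ℤ) < q * d := by positivity
      linarith
    have h2 : t ≤ 2 * q * d * t := by nlinarith
    nlinarith
  have hmaps : ∀ z ∈ F, (z.1.1 - z.1.2).toNat ∈ Finset.Icc 1 P := by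
    intro z hz
    obtain ⟨t, s, ht, hs, ht0, -, h1, -, h2, h3⟩ := key z hz
    have h4 := hsmall t s ht0 h1
    rw [← ht, Finset.mem_Icc]
    constructor
    · omega
    · have : t ≤ P := by linarith
      omega
  rw [Finset.card_eq_sum_card_fiberwise hmaps]
  refine Finset.sum_le_sum fun t ht => ?_
  rw [Finset.mem_Icc] at ht
  set n := 2 * q * d * t with hn
  have htZ : (0 : ℤ) < t := by exact_mod_cast ht.1
  have hn0 : 0 < n := by have := ht.1; positivity
  have hsub : 2 ≤ κ ^ 2 - 2 := by
    have : 2 ^ 2 ≤ κ ^ 2 := Nat.pow_le_pow_left hκ 2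
    omega
  have hκ2 : 4 ≤ κ ^ 2 := by omega
  have hcast : ((κ ^ 2 - 2 : ℕ) : ℤ) = (κ : ℤ) ^ 2 - 2 := by
    rw [Nat.cast_sub (by omega)]; push_cast; ring
  by_cases hbig : (κ ^ 2 - 2) * n < P
  · set L := (P - (κ ^ 2 - 2) * n) / n + 1 with hL
    have hLn : L * n ≤ P - (κ ^ 2 - 3) * (2 * q * d) * t := by
      have h1 : (P - (κ ^ 2 - 2) * n) / n * n ≤ P - (κ ^ 2 - 2) * n := Nat.div_mul_le_self _ _
      have h2 : (κ ^ 2 - 2) * n = (κ ^ 2 - 3) * (2 * q * d) * t + n := by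
        obtain ⟨k, hk⟩ : ∃ k, κ ^ 2 = k + 3 := ⟨κ ^ 2 - 3, by omega⟩
        rw [hk, show k + 3 - 2 = k + 1 by omega, show k + 3 - 3 = k by omega, hn]
        ring
      rw [hL, add_mul, one_mul]
      omega
    have hLn' : P - (κ ^ 2 - 2) * n < L * n := by
      have := Nat.lt_mul_div_succ (P - (κ ^ 2 - 2) * n) hn0
      rwa [mul_comm n] at this
    have hrect := card_congruence_le q d t hq hd ht.1 h2q hdq y₀ c (x₀ + q * d * t)
      ((κ ^ 2 - 2) * (2 * q * d * t)) (κ ^ 2 * P) hy (κ + 4) L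
    rw [← hn] at hrect
    refine le_trans ?_ (hrect.trans (Nat.mul_le_mul_left _ (Nat.mul_le_mul_right _ hLn)))
    refine Finset.card_le_card_of_injOn (fun z => (z.2.2 - z.2.1, z.2.1)) ?_ ?_
    · intro z hz
      simp only [Finset.coe_filter, Set.mem_ofPred_eq] at hz
      obtain ⟨t', s, ht', hs, ht0, he, h1, h2, h3, h4⟩ := key z hz.1
      have htt : t' = t := by rw [ht', ← hz.2]; omega
      subst htt
      simp only [Finset.coe_filter, Set.mem_ofPred_eq, Finset.mem_product, Finset.mem_Ico,
        ← hs]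
      have hnZ : (n : ℤ) = 2 * q * d * t := by rw [hn]; push_cast; ring
      refine ⟨⟨⟨h1, ?_⟩, h3, ?_⟩, ⟨z.1.2, ?_⟩⟩
      · rw [hnZ]; push_cast; linarith
      · have h5 : ((P - (κ ^ 2 - 2) * n : ℕ) : ℤ) < L * n := by exact_mod_cast hLn'
        rw [Nat.cast_sub hbig.le, Nat.cast_mul, hcast, hnZ] at h5
        rw [hnZ]
        linarith
      · rw [hnZ]; linear_combination -he
    · intro z hz z' hz' h
      simp only [Finset.coe_filter, Set.mem_ofPred_eq] at hz hz'
      simp only [Prod.mk.injEq] at h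
      obtain ⟨u, s, hu, hs, hu0, he, -⟩ := key z hz.1
      obtain ⟨u', s', hu', hs', hu0', he', -⟩ := key z' hz'.1
      have e1 : u = t := by rw [hu, ← hz.2]; omega
      have e2 : u' = t := by rw [hu', ← hz'.2]; omega
      have e3 : s = s' := by rw [hs, hs', h.1]
      rw [e1] at he
      rw [e2, ← e3, ← h.2] at he'
      have e4 : (2 * q * d * t : ℤ) * z.1.2 = (2 * q * d * t) * z'.1.2 := by
        linear_combination he - he'
      have e5 : z.1.2 = z'.1.2 := mul_left_cancel₀ (by positivity) e4
      have e6 : z.1.1 = z'.1.1 := by linarith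
      exact Prod.ext (Prod.ext e6 e5) (Prod.ext h.2 (by linarith [h.1, h.2]))
  · have hempty : (F.filter (fun z => (z.1.1 - z.1.2).toNat = t)) = ∅ := by
      rw [Finset.filter_eq_empty_iff]
      intro z hz hzt
      obtain ⟨t', s, ht', hs, ht0, he, h1, h2, h3, h4⟩ := key z hz
      have htt : t' = t := by rw [ht', ← hzt]; omega
      subst htt
      apply hbig
      zify
      rw [hcast, hn]
      push_cast
      linarith
    rw [hempty]
    simp

lemma sum_tsub_mul_le (P a J : ℕ) (ha : 0 < a) :
    ∑ j ∈ Finset.Icc 1 J, ((P - a * j : ℕ) : ℝ) ≤ (P : ℝ) ^ 2 / (2 * a) := by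
  have haR : (0 : ℝ) < a := by exact_mod_cast ha
  suffices h : ∑ j ∈ Finset.Icc 1 J, ((P - a * j : ℕ) : ℝ) +
      ((P - a * J : ℕ) : ℝ) ^ 2 / (2 * a) ≤ (P : ℝ) ^ 2 / (2 * a) by
    have : 0 ≤ ((P - a * J : ℕ) : ℝ) ^ 2 / (2 * a) := by positivity
    linarith
  induction J with
  | zero => simp
  | succ J ih =>
    rw [Finset.sum_Icc_succ_top (by omega)]
    refine le_trans ?_ ih
    rw [add_assoc]
    gcongr
    rcases le_or_gt (a * (J + 1)) P with h | h
    · have h1 : P - a * J = (P - a * (J + 1)) + a := by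
        rw [mul_add] at h ⊢; omega
      rw [h1]
      push_cast
      set u := ((P - a * (J + 1) : ℕ) : ℝ)
      rw [← sub_nonneg]
      have : (u + a) ^ 2 / (2 * a) - (u + u ^ 2 / (2 * a)) = a / 2 := by
        field_simp; ring
      rw [this]
      positivity
    · rw [Nat.sub_eq_zero_of_le h.le]
      simp only [Nat.cast_zero, ne_eq, OfNat.ofNat_ne_zero, not_false_eq_true, zero_pow,
        zero_div, add_zero]
      positivity

/-- The sum of the reciprocals of the divisors `g ≤ P` of `c` coprime to `q`. -/
noncomputable def recipSum (q P : ℕ) (c : ℤ) : ℝ :=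
  ∑ g ∈ (Finset.Icc 1 P).filter (fun g : ℕ => (g : ℤ) ∣ c ∧ g.Coprime q), (1 / g : ℝ)

lemma sum_tsub_mul_card_divisors_le (q P a : ℕ) (ha : 0 < a) (c : ℤ) :
    ((∑ t ∈ Finset.Icc 1 P, (P - a * t) *
      (t.divisors.filter (fun g : ℕ => (g : ℤ) ∣ c ∧ g.Coprime q)).card : ℕ) : ℝ) ≤
      (P : ℝ) ^ 2 / (2 * a) * recipSum q P c := by
  classical
  have h1 : ∀ t ∈ Finset.Icc 1 P,
      (t.divisors.filter (fun g : ℕ => (g : ℤ) ∣ c ∧ g.Coprime q)).card =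
      ∑ g ∈ (Finset.Icc 1 P).filter (fun g : ℕ => (g : ℤ) ∣ c ∧ g.Coprime q),
        if g ∣ t then 1 else 0 := by
    intro t ht
    rw [Finset.mem_Icc] at ht
    rw [← Finset.card_filter]
    congr 1
    ext g
    simp only [Finset.mem_filter, Nat.mem_divisors, Finset.mem_Icc]
    constructor
    · rintro ⟨⟨h, h'⟩, h2⟩
      exact ⟨⟨⟨Nat.pos_of_dvd_of_pos h ht.1, (Nat.le_of_dvd ht.1 h).trans ht.2⟩, h2⟩, h⟩
    · rintro ⟨⟨-, h2⟩, h⟩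
      exact ⟨⟨h, by omega⟩, h2⟩
  rw [Finset.sum_congr rfl (fun t ht => by rw [h1 t ht, Finset.mul_sum]), Finset.sum_comm,
    recipSum, Finset.mul_sum]
  push_cast
  refine Finset.sum_le_sum fun g hg => ?_
  have hg0 : 0 < g := (Finset.mem_Icc.mp (Finset.mem_filter.mp hg).1).1
  calc ∑ t ∈ Finset.Icc 1 P, ((P - a * t : ℕ) : ℝ) * (if g ∣ t then 1 else 0)
      = ∑ t ∈ (Finset.Icc 1 P).filter (g ∣ ·), ((P - a * t : ℕ) : ℝ) := by
        rw [Finset.sum_filter]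
        exact Finset.sum_congr rfl fun t _ => by split_ifs <;> simp
    _ ≤ ∑ t ∈ (Finset.Icc 1 P).image (g * ·), ((P - a * t : ℕ) : ℝ) := by
        refine Finset.sum_le_sum_of_subset_of_nonneg ?_ fun _ _ _ => by positivity
        intro t ht
        simp only [Finset.mem_filter, Finset.mem_Icc] at ht
        obtain ⟨⟨ht1, ht2⟩, j, rfl⟩ := ht
        rw [Finset.mem_image]
        refine ⟨j, Finset.mem_Icc.mpr ⟨Nat.pos_of_mul_pos_left ht1, ?_⟩, rfl⟩
        exact (Nat.le_mul_of_pos_left j hg0).trans ht2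
    _ = ∑ j ∈ Finset.Icc 1 P, ((P - (a * g) * j : ℕ) : ℝ) := by
        rw [Finset.sum_image fun x _ y _ h => Nat.eq_of_mul_eq_mul_left hg0 h]
        exact Finset.sum_congr rfl fun j _ => by rw [mul_assoc]
    _ ≤ (P : ℝ) ^ 2 / (2 * (a * g : ℕ)) := sum_tsub_mul_le _ _ _ (by positivity)
    _ = (P : ℝ) ^ 2 / (2 * a) * (1 / g) := by
        push_cast
        field_simp

lemma recipSum_neg (q P : ℕ) (c : ℤ) : recipSum q P (-c) = recipSum q P c := by
  simp [recipSum]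

lemma card_collisions_gt_le_recipSum (q d κ P : ℕ) (hq : 0 < q) (hd : 0 < d) (hκ : 2 ≤ κ) (hP : 0 < P)
    (h2q : 2 ∣ q) (hdq : ∀ p : ℕ, p.Prime → p ∣ d → p ∣ q) (x₀ y₀ c : ℤ)
    (hx₀ : 0 ≤ x₀) (hx₀' : x₀ ≤ 2 * q * d) (hy₀ : 0 ≤ y₀) (hy₀' : y₀ ≤ 2 * q)
    (hy : IsCoprime y₀ (q : ℤ)) (hc : |c| ≤ P) :
    (((collisions q d κ P x₀ y₀ c).filter (fun z => z.1.2 < z.1.1)).card : ℝ) ≤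
      (κ + 4) * ((P : ℝ) ^ 2 / (2 * ((κ ^ 2 - 3) * (2 * q * d)))) * recipSum q P c := by
  have hκ2 : 4 ≤ κ ^ 2 := by
    have : 2 ^ 2 ≤ κ ^ 2 := Nat.pow_le_pow_left hκ 2
    omega
  have h := card_collisions_gt_le q d κ P hq hd hκ hP h2q hdq x₀ y₀ c hx₀ hx₀' hy₀ hy₀' hy hc
  rw [← Finset.mul_sum] at h
  have hpos : 0 < (κ ^ 2 - 3) * (2 * q * d) := by
    have : 0 < κ ^ 2 - 3 := by omega
    positivity
  have h2 := sum_tsub_mul_card_divisors_le q P ((κ ^ 2 - 3) * (2 * q * d)) hpos c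
  have h3 : (((collisions q d κ P x₀ y₀ c).filter (fun z => z.1.2 < z.1.1)).card : ℝ) ≤
      (κ + 4) * _ := le_trans (by exact_mod_cast h) (mul_le_mul_of_nonneg_left h2 (by positivity))
  rw [Nat.cast_mul, Nat.cast_sub (show 3 ≤ κ ^ 2 by omega)] at h3
  push_cast at h3
  rwa [← mul_assoc] at h3

lemma card_collisions_eq_le (q d κ P : ℕ) (hq : 0 < q) (hκ : 2 ≤ κ) (hP : 0 < P)
    (x₀ y₀ c : ℤ) (hy₀ : 0 ≤ y₀) (hc : |c| ≤ P) :
    ((collisions q d κ P x₀ y₀ c).filter (fun z => z.1.1 = z.1.2)).card ≤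
      if c = 0 then 2 * q * κ ^ 3 * P * P else 0 := by
  have hqZ : (0 : ℤ) < q := by exact_mod_cast hq
  have hκZ : (2 : ℤ) ≤ κ := by exact_mod_cast hκ
  have hPZ : (0 : ℤ) < P := by exact_mod_cast hP
  have key : ∀ z ∈ collisions q d κ P x₀ y₀ c, z.1.1 = z.1.2 → c = 0 ∧ z.2.1 = z.2.2 := by
    intro z hz hzz
    simp only [collisions, Finset.mem_filter, Finset.mem_product, Finset.mem_Ico] at hz
    obtain ⟨⟨-, ⟨hη1, hη2⟩, hη3, hη4⟩, heq⟩ := hz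
    rw [hzz] at heq
    have he : (z.2.1 - z.2.2) * (y₀ + q * (z.2.1 + z.2.2)) = c := by linear_combination heq
    have hw : (P : ℤ) < y₀ + q * (z.2.1 + z.2.2) := by
      have h1 : (4 : ℤ) * P ≤ κ ^ 2 * P :=
        mul_le_mul_of_nonneg_right (by nlinarith) hPZ.le
      nlinarith
    have h0 : z.2.1 - z.2.2 = 0 := by
      by_contra hne
      have h1 : 1 ≤ |z.2.1 - z.2.2| := Int.one_le_abs hne
      have h2 : |z.2.1 - z.2.2| * |y₀ + q * (z.2.1 + z.2.2)| ≤ P := by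
        rw [← abs_mul, he]; exact hc
      have h3 := le_abs_self (y₀ + q * (z.2.1 + z.2.2))
      nlinarith
    refine ⟨by rw [← he, h0, zero_mul], by linarith⟩
  split_ifs with h0
  · have : 2 * q * κ ^ 3 * P * P =
        (Finset.Ico (2 * q * κ ^ 4 * P : ℤ) (2 * q * κ ^ 4 * P + 2 * q * κ ^ 3 * P) ×ˢ
        Finset.Ico (κ ^ 2 * P : ℤ) (κ ^ 2 * P + P)).card := by
      rw [Finset.card_product, Int.card_Ico, Int.card_Ico, add_sub_cancel_left,
        add_sub_cancel_left, Int.toNat_natCast]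
      congr 1
    rw [this]
    refine Finset.card_le_card_of_injOn (fun z => (z.1.1, z.2.1)) ?_ ?_
    · intro z hz
      simp only [Finset.coe_filter, Set.mem_ofPred_eq] at hz
      have := hz.1
      simp only [collisions, Finset.mem_filter, Finset.mem_product] at this
      simp only [Finset.coe_product, Set.mem_prod, Finset.mem_coe]
      exact ⟨this.1.1.1, this.1.2.1⟩
    · intro z hz z' hz' h
      simp only [Finset.coe_filter, Set.mem_ofPred_eq] at hz hz'
      simp only [Prod.mk.injEq] at h
      refine Prod.ext (Prod.ext h.1 ?_) (Prod.ext h.2 ?_)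
      · rw [← hz.2, ← hz'.2, h.1]
      · rw [← (key z hz.1 hz.2).2, ← (key z' hz'.1 hz'.2).2, h.2]
  · rw [Nat.le_zero, Finset.card_eq_zero, Finset.filter_eq_empty_iff]
    exact fun z hz hzz => h0 (key z hz hzz).1

lemma card_collisions_lt (q d κ P : ℕ) (x₀ y₀ c : ℤ) :
    ((collisions q d κ P x₀ y₀ c).filter (fun z => z.1.1 < z.1.2)).card =
      ((collisions q d κ P x₀ y₀ (-c)).filter (fun z => z.1.2 < z.1.1)).card := by
  refine Finset.card_bij' (fun z _ => (z.1.swap, z.2.swap)) (fun z _ => (z.1.swap, z.2.swap))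
    ?_ ?_ (fun _ _ => rfl) (fun _ _ => rfl)
  all_goals
    intro z hz
    simp only [collisions, Finset.mem_filter, Finset.mem_product, Prod.fst_swap,
      Prod.snd_swap] at hz ⊢
    obtain ⟨⟨⟨⟨h1, h2⟩, h3, h4⟩, h5⟩, h6⟩ := hz
    exact ⟨⟨⟨⟨h2, h1⟩, h4, h3⟩, by linarith⟩, h6⟩

lemma card_collisions_le (q d κ P : ℕ) (hq : 0 < q) (hd : 0 < d) (hκ : 2 ≤ κ) (hP : 0 < P)
    (h2q : 2 ∣ q) (hdq : ∀ p : ℕ, p.Prime → p ∣ d → p ∣ q) (x₀ y₀ c : ℤ)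
    (hx₀ : 0 ≤ x₀) (hx₀' : x₀ ≤ 2 * q * d) (hy₀ : 0 ≤ y₀) (hy₀' : y₀ ≤ 2 * q)
    (hy : IsCoprime y₀ (q : ℤ)) (hc : |c| ≤ P) :
    ((collisions q d κ P x₀ y₀ c).card : ℝ) ≤
      (κ + 4) * (P : ℝ) ^ 2 / ((κ ^ 2 - 3) * (2 * q * d)) * recipSum q P c +
      if c = 0 then (2 * q * κ ^ 3 * P * P : ℝ) else 0 := by
  classical
  have h1 := card_collisions_gt_le_recipSum q d κ P hq hd hκ hP h2q hdq x₀ y₀ c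
    hx₀ hx₀' hy₀ hy₀' hy hc
  have h2 := card_collisions_gt_le_recipSum q d κ P hq hd hκ hP h2q hdq x₀ y₀ (-c)
    hx₀ hx₀' hy₀ hy₀' hy (by rwa [abs_neg])
  rw [← card_collisions_lt, recipSum_neg] at h2
  have h3 := card_collisions_eq_le q d κ P hq hκ hP x₀ y₀ c hy₀ hc
  have h4 : (collisions q d κ P x₀ y₀ c).card ≤
      ((collisions q d κ P x₀ y₀ c).filter (fun z => z.1.2 < z.1.1)).card +
      ((collisions q d κ P x₀ y₀ c).filter (fun z => z.1.1 < z.1.2)).card +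
      ((collisions q d κ P x₀ y₀ c).filter (fun z => z.1.1 = z.1.2)).card := by
    refine le_trans (Finset.card_le_card ?_)
      ((Finset.card_union_le _ _).trans (Nat.add_le_add_right (Finset.card_union_le _ _) _))
    intro z hz
    simp only [Finset.mem_union, Finset.mem_filter]
    rcases lt_trichotomy z.1.1 z.1.2 with h | h | h
    · exact Or.inl (Or.inr ⟨hz, h⟩)
    · exact Or.inr ⟨hz, h⟩
    · exact Or.inl (Or.inl ⟨hz, h⟩)
  have h3' : (((collisions q d κ P x₀ y₀ c).filter (fun z => z.1.1 = z.1.2)).card : ℝ) ≤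
      if c = 0 then (2 * q * κ ^ 3 * P * P : ℝ) else 0 := by
    split_ifs at h3 ⊢ with h0
    · exact_mod_cast h3
    · exact_mod_cast h3
  have h4' : ((collisions q d κ P x₀ y₀ c).card : ℝ) ≤
      ((collisions q d κ P x₀ y₀ c).filter (fun z => z.1.2 < z.1.1)).card +
      ((collisions q d κ P x₀ y₀ c).filter (fun z => z.1.1 < z.1.2)).card +
      ((collisions q d κ P x₀ y₀ c).filter (fun z => z.1.1 = z.1.2)).card := by
    exact_mod_cast h4
  refine (h4'.trans (add_le_add_three h1 h2 h3')).trans (le_of_eq ?_)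
  congr 1
  rw [mul_comm (2 : ℝ) ((κ ^ 2 - 3) * (2 * q * d)), ← div_div]
  ring

lemma sum_one_div_divisors_le (Z : ℕ) (hZ : 0 < Z) (k v : ℕ) (hv : 0 < v)
    (hrough : ∀ p : ℕ, p.Prime → p ∣ v → Z ≤ p) (hk : v ≤ Z ^ k) :
    ∑ g ∈ v.divisors, (1 / g : ℝ) ≤ (1 + 1 / Z) ^ k := by
  induction k generalizing v with
  | zero =>
    have : v = 1 := by simp at hk; omega
    subst this
    simp
  | succ k ih =>
    by_cases hv1 : v = 1
    · subst hv1
      simp only [Nat.divisors_one, Finset.sum_singleton, Nat.cast_one, div_one]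
      exact one_le_pow₀ (by linarith [show (0 : ℝ) ≤ 1 / Z by positivity])
    · obtain ⟨p, hp, m, rfl⟩ := Nat.exists_prime_and_dvd hv1
      have hm : 0 < m := Nat.pos_of_mul_pos_left hv
      have hZp := hrough p hp (dvd_mul_right _ _)
      have hmk : m ≤ Z ^ k := by
        rw [pow_succ'] at hk
        exact Nat.le_of_mul_le_mul_left ((Nat.mul_le_mul_right m hZp).trans hk) hZ
      have ihm := ih m hm (fun l hl h => hrough l hl (h.mul_left p)) hmk
      have hsub : (p * m).divisors ⊆ m.divisors ∪ m.divisors.image (p * ·) := by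
        intro g hg
        have hgd := (Nat.mem_divisors.mp hg).1
        rw [Finset.mem_union]
        by_cases hpg : p ∣ g
        · right
          obtain ⟨g', rfl⟩ := hpg
          exact Finset.mem_image.mpr ⟨g', Nat.mem_divisors.mpr
            ⟨Nat.dvd_of_mul_dvd_mul_left hp.pos hgd, hm.ne'⟩, rfl⟩
        · left
          exact Nat.mem_divisors.mpr
            ⟨(((Nat.Prime.coprime_iff_not_dvd hp).mpr hpg).symm).dvd_of_dvd_mul_left hgd, hm.ne'⟩
      have hZR : (0 : ℝ) < Z := by exact_mod_cast hZ
      have hpR : (Z : ℝ) ≤ p := by exact_mod_cast hZp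
      calc ∑ g ∈ (p * m).divisors, (1 / g : ℝ)
          ≤ ∑ g ∈ m.divisors ∪ m.divisors.image (p * ·), (1 / g : ℝ) :=
            Finset.sum_le_sum_of_subset_of_nonneg hsub fun _ _ _ => by positivity
        _ ≤ ∑ g ∈ m.divisors, (1 / g : ℝ) + ∑ g ∈ m.divisors.image (p * ·), (1 / g : ℝ) := by
            rw [← Finset.sum_union_inter]
            have : (0 : ℝ) ≤ ∑ g ∈ m.divisors ∩ m.divisors.image (p * ·), (1 / g : ℝ) :=
              Finset.sum_nonneg fun _ _ => by positivity
            linarith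
        _ = (1 + 1 / p) * ∑ g ∈ m.divisors, (1 / g : ℝ) := by
            rw [Finset.sum_image fun x _ y _ h => Nat.eq_of_mul_eq_mul_left hp.pos h, add_mul,
              one_mul, Finset.mul_sum]
            congr 1
            refine Finset.sum_congr rfl fun g _ => ?_
            push_cast
            rw [div_mul_div_comm, one_mul]
        _ ≤ (1 + 1 / Z) * (1 + 1 / Z) ^ k := by gcongr
        _ = (1 + 1 / Z) ^ (k + 1) := by rw [pow_succ']

lemma recipSum_le_pow (q P Z k : ℕ) (hZ : 0 < Z) (hq : ∀ p : ℕ, p.Prime → p ≤ Z → p ∣ q)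
    (c : ℤ) (hc : c ≠ 0) (hk : c.natAbs ≤ Z ^ k) :
    recipSum q P c ≤ (1 + 1 / Z) ^ k := by
  obtain ⟨u, v, huv, hv, hu⟩ := exists_mul_coprime_part q c.natAbs (Int.natAbs_pos.mpr hc)
  have hv0 : 0 < v := by
    rcases Nat.eq_zero_or_pos v with h | h
    · simp [h, hc] at huv
    · exact h
  have hu0 : 0 < u := by
    rcases Nat.eq_zero_or_pos u with h | h
    · simp [h, hc] at huv
    · exact h
  refine le_trans ?_ (sum_one_div_divisors_le Z hZ k v hv0 ?_ ?_)
  · refine Finset.sum_le_sum_of_subset_of_nonneg ?_ fun _ _ _ => by positivity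
    intro g hg
    obtain ⟨hg1, hg2, hg3⟩ := Finset.mem_filter.mp hg
    refine Nat.mem_divisors.mpr ⟨?_, hv0.ne'⟩
    have h1 : g ∣ u * v := by rw [← huv]; exact Int.natCast_dvd.mp hg2
    have h2 : IsCoprime (g : ℤ) (u : ℤ) :=
      isCoprime_of_forall_prime_dvd (Nat.isCoprime_iff_coprime.mpr hg3) hu
    exact (Nat.isCoprime_iff_coprime.mp h2).dvd_of_dvd_mul_left h1
  · intro p hp hpv
    by_contra hlt
    have h1 := hq p hp (by omega)
    have h2 := Nat.dvd_gcd hpv h1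
    rw [hv] at h2
    exact hp.one_lt.ne' (Nat.dvd_one.mp h2)
  · exact le_trans (by rw [huv]; exact Nat.le_mul_of_pos_left v hu0) hk

lemma recipSum_le_log (q P : ℕ) (c : ℤ) : recipSum q P c ≤ 1 + Real.log P := by
  refine le_trans ?_ (harmonic_le_one_add_log P)
  rw [harmonic_eq_sum_Icc, recipSum]
  push_cast
  simp only [one_div]
  exact Finset.sum_le_sum_of_subset_of_nonneg (Finset.filter_subset _ _)
    fun _ _ _ => by positivity

/-- The Cauchy–Schwarz lower bound for the size of an image in terms of the number of collisions. -/
lemma card_sq_le_card_image_mul_card_collisions {α β : Type*} [DecidableEq β]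
    (s : Finset α) (f : α → β) :
    s.card ^ 2 ≤ (s.image f).card * ((s ×ˢ s).filter (fun z => f z.1 = f z.2)).card := by
  classical
  have h1 : s.card = ∑ b ∈ s.image f, (s.filter (fun a => f a = b)).card :=
    Finset.card_eq_sum_card_image f s
  have h2 : ((s ×ˢ s).filter (fun z => f z.1 = f z.2)).card
      = ∑ b ∈ s.image f, (s.filter (fun a => f a = b)).card ^ 2 := by
    rw [Finset.card_eq_sum_card_fiberwise (f := fun z => f z.1) (t := s.image f)]
    · refine Finset.sum_congr rfl fun b _ => ?_
      rw [sq, ← Finset.card_product]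
      congr 1
      ext z
      simp only [Finset.mem_filter, Finset.mem_product]
      grind
    · intro z hz
      simp only [Finset.coe_filter, Finset.mem_product, Set.mem_ofPred_eq] at hz
      exact Finset.mem_coe.2 (Finset.mem_image_of_mem f hz.1.1)
  rw [h1, h2]
  exact sq_sum_le_card_mul_sum_sq

/-- The box of parameters. -/
noncomputable def box (q κ P M : ℕ) : Finset ((ℤ × ℤ) × ℕ) :=
  (Finset.Ico (2 * q * κ ^ 4 * P : ℤ) (2 * q * κ ^ 4 * P + 2 * q * κ ^ 3 * P) ×ˢ
    Finset.Ico (κ ^ 2 * P : ℤ) (κ ^ 2 * P + P)) ×ˢ Finset.range M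

/-- The value of the polynomial `x² + d y² - m ^ r`, reduced along a residue class. -/
def boxValue (q d : ℕ) (x₀ y₀ : ℤ) (C : ℕ → ℤ) (z : (ℤ × ℤ) × ℕ) : ℤ :=
  x₀ * z.1.1 + q * d * z.1.1 ^ 2 + (y₀ * z.1.2 + q * z.1.2 ^ 2) - C z.2

lemma card_box (q κ P M : ℕ) : (box q κ P M).card = 2 * q * κ ^ 3 * P * P * M := by
  simp only [box, Finset.card_product, Int.card_Ico, Finset.card_range]
  congr 2
  · rw [add_sub_cancel_left]; exact_mod_cast Int.toNat_natCast (2 * q * κ ^ 3 * P)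
  · simp

lemma card_box_collisions_le (q d κ P M : ℕ) (x₀ y₀ : ℤ) (C : ℕ → ℤ) :
    ((box q κ P M ×ˢ box q κ P M).filter
      (fun z => boxValue q d x₀ y₀ C z.1 = boxValue q d x₀ y₀ C z.2)).card ≤
    ∑ w ∈ Finset.range M ×ˢ Finset.range M,
      (collisions q d κ P x₀ y₀ (C w.1 - C w.2)).card := by
  rw [Finset.card_eq_sum_card_fiberwise (f := fun z => (z.1.2, z.2.2))
    (t := Finset.range M ×ˢ Finset.range M)]
  · refine Finset.sum_le_sum fun w _ => ?_
    refine Finset.card_le_card_of_injOn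
      (fun z => ((z.1.1.1, z.2.1.1), (z.1.1.2, z.2.1.2))) ?_ ?_
    · rintro ⟨⟨⟨a, b⟩, m⟩, ⟨⟨a', b'⟩, m'⟩⟩ hz
      rw [Finset.mem_coe, Finset.mem_filter, Finset.mem_filter] at hz
      simp only [box, boxValue, collisions, Finset.mem_coe, Finset.mem_filter,
        Finset.mem_product] at hz ⊢
      obtain ⟨⟨⟨⟨⟨h1, h2⟩, h3⟩, ⟨⟨h4, h5⟩, h6⟩⟩, h7⟩, rfl⟩ := hz
      refine ⟨⟨⟨h1, h4⟩, h2, h5⟩, ?_⟩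
      simp only
      linarith
    · rintro ⟨⟨⟨a, b⟩, m⟩, ⟨⟨a', b'⟩, m'⟩⟩ hz ⟨⟨⟨e, f⟩, n⟩, ⟨⟨e', f'⟩, n'⟩⟩ hz' h
      simp only [Finset.coe_filter, Finset.mem_filter, Set.mem_ofPred_eq] at hz hz'
      grind
  · intro z hz
    simp only [box, Finset.coe_filter, Finset.mem_product, Set.mem_ofPred_eq] at hz
    simp only [Finset.coe_product, Set.mem_prod, Finset.mem_coe]
    exact ⟨hz.1.1.2, hz.1.2.2⟩

lemma card_box_sq_le (q d κ P M : ℕ) (hq : 0 < q) (hd : 0 < d) (hκ : 2 ≤ κ) (hP : 0 < P)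
    (h2q : 2 ∣ q) (hdq : ∀ p : ℕ, p.Prime → p ∣ d → p ∣ q) (x₀ y₀ : ℤ)
    (hx₀ : 0 ≤ x₀) (hx₀' : x₀ ≤ 2 * q * d) (hy₀ : 0 ≤ y₀) (hy₀' : y₀ ≤ 2 * q)
    (hy : IsCoprime y₀ (q : ℤ)) (C : ℕ → ℤ)
    (hC : ∀ i < M, ∀ j < M, |C i - C j| ≤ P) (h : ℝ) (h0 : 0 ≤ h)
    (hh : ∀ i < M, ∀ j < M, i ≠ j → C i ≠ C j ∧ recipSum q P (C i - C j) ≤ h) :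
    ((2 * q * κ ^ 3 * P * P * M : ℕ) : ℝ) ^ 2 ≤
      ((box q κ P M).image (boxValue q d x₀ y₀ C)).card *
      ((M : ℝ) ^ 2 * ((κ + 4) * (P : ℝ) ^ 2 / ((κ ^ 2 - 3) * (2 * q * d)) * h) +
        M * ((κ + 4) * (P : ℝ) ^ 2 / ((κ ^ 2 - 3) * (2 * q * d)) * (1 + Real.log P)
          + 2 * q * κ ^ 3 * P * P)) := by
  have hCS := card_sq_le_card_image_mul_card_collisions (box q κ P M) (boxValue q d x₀ y₀ C)
  rw [card_box] at hCS
  have hE := card_box_collisions_le q d κ P M x₀ y₀ C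
  have hCS' : ((2 * q * κ ^ 3 * P * P * M : ℕ) : ℝ) ^ 2 ≤
      ((box q κ P M).image (boxValue q d x₀ y₀ C)).card *
      ((∑ w ∈ Finset.range M ×ˢ Finset.range M,
        (collisions q d κ P x₀ y₀ (C w.1 - C w.2)).card : ℕ) : ℝ) := by
    exact_mod_cast hCS.trans (Nat.mul_le_mul_left _ hE)
  refine hCS'.trans (mul_le_mul_of_nonneg_left ?_ (by positivity))
  set A : ℝ := (κ + 4) * (P : ℝ) ^ 2 / ((κ ^ 2 - 3) * (2 * q * d)) with hA
  have hA0 : 0 ≤ A := by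
    have : (2 : ℝ) ≤ κ := by exact_mod_cast hκ
    have : (0 : ℝ) ≤ κ ^ 2 - 3 := by nlinarith
    positivity
  have hterm : ∀ w ∈ Finset.range M ×ˢ Finset.range M,
      ((collisions q d κ P x₀ y₀ (C w.1 - C w.2)).card : ℝ) ≤
      A * h + if w.1 = w.2 then A * (1 + Real.log P) + 2 * q * κ ^ 3 * P * P else 0 := by
    rintro ⟨i, j⟩ hw
    simp only [Finset.mem_product, Finset.mem_range] at hw ⊢
    have hcol := card_collisions_le q d κ P hq hd hκ hP h2q hdq x₀ y₀ (C i - C j) hx₀ hx₀' hy₀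
      hy₀' hy (hC i hw.1 j hw.2)
    rw [← hA] at hcol
    refine hcol.trans ?_
    by_cases hij : i = j
    · have h1 := mul_le_mul_of_nonneg_left (recipSum_le_log q P (C i - C j)) hA0
      have h2 := mul_nonneg hA0 h0
      rw [if_pos hij, if_pos (by rw [hij, sub_self])]
      linarith
    · obtain ⟨hne, hle⟩ := hh i hw.1 j hw.2 hij
      have h1 := mul_le_mul_of_nonneg_left hle hA0
      rw [if_neg hij, if_neg (sub_ne_zero.2 hne)]
      linarith
  push_cast
  refine (Finset.sum_le_sum hterm).trans (le_of_eq ?_)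
  rw [Finset.sum_add_distrib, Finset.sum_const, Finset.card_product, Finset.card_range,
    Finset.sum_product]
  simp only [Finset.sum_ite_eq, Finset.sum_ite_mem, Finset.inter_self, Finset.sum_const,
    Finset.card_range, nsmul_eq_mul]
  push_cast
  ring

/-- Every residue class modulo `n` is represented by `x² + d y² - m ^ r` with `y` prime to `n`. -/
def LocallySoluble (d r n : ℕ) : Prop :=
  ∀ k : ℤ, ∃ x y m : ℤ, IsCoprime y (n : ℤ) ∧ (n : ℤ) ∣ x ^ 2 + d * y ^ 2 - m ^ r - k

lemma LocallySoluble.of_dvd {d r n n' : ℕ} (h : LocallySoluble d r n) (hn : n' ∣ n) :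
    LocallySoluble d r n' := by
  intro k
  obtain ⟨x, y, m, hy, hk⟩ := h k
  have hn' : (n' : ℤ) ∣ n := by exact_mod_cast hn
  exact ⟨x, y, m, hy.of_isCoprime_of_dvd_right hn', hn'.trans hk⟩

lemma IsCoprime.exists_dvd_sub {a b : ℤ} (h : IsCoprime a b) (u v : ℤ) :
    ∃ w : ℤ, a ∣ w - u ∧ b ∣ w - v := by
  obtain ⟨s, t, hst⟩ := h
  refine ⟨u * (t * b) + v * (s * a), ⟨s * (v - u), ?_⟩, ⟨t * (u - v), ?_⟩⟩
  · linear_combination u * hst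
  · linear_combination v * hst

lemma dvd_form_sub_form {a x x' y y' m m' : ℤ} (d r : ℕ) (hx : a ∣ x - x') (hy : a ∣ y - y')
    (hm : a ∣ m - m') :
    a ∣ (x ^ 2 + d * y ^ 2 - m ^ r) - (x' ^ 2 + d * y' ^ 2 - m' ^ r) := by
  have h1 := hx.trans (sub_dvd_pow_sub_pow x x' 2)
  have h2 := (hy.trans (sub_dvd_pow_sub_pow y y' 2)).mul_left (d : ℤ)
  have h3 := hm.trans (sub_dvd_pow_sub_pow m m' r)
  obtain ⟨c, hc⟩ := (h1.add h2).sub h3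
  exact ⟨c, by linear_combination hc⟩

lemma IsCoprime.of_dvd_sub {a y y' : ℤ} (h : IsCoprime y' a) (hy : a ∣ y - y') :
    IsCoprime y a := by
  obtain ⟨c, hc⟩ := hy
  rw [show y = y' + a * c by linarith]
  exact h.add_mul_left_left c

lemma LocallySoluble.mul {d r a b : ℕ} (ha : LocallySoluble d r a) (hb : LocallySoluble d r b)
    (hab : a.Coprime b) : LocallySoluble d r (a * b) := by
  intro k
  obtain ⟨x₁, y₁, m₁, hy₁, hk₁⟩ := ha k
  obtain ⟨x₂, y₂, m₂, hy₂, hk₂⟩ := hb k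
  have hab' : IsCoprime (a : ℤ) b := Nat.isCoprime_iff_coprime.2 hab
  obtain ⟨x, hx₁, hx₂⟩ := hab'.exists_dvd_sub x₁ x₂
  obtain ⟨y, hya, hyb⟩ := hab'.exists_dvd_sub y₁ y₂
  obtain ⟨m, hm₁, hm₂⟩ := hab'.exists_dvd_sub m₁ m₂
  refine ⟨x, y, m, ?_, ?_⟩
  · push_cast
    exact (hy₁.of_dvd_sub hya).mul_right (hy₂.of_dvd_sub hyb)
  · push_cast
    refine hab'.mul_dvd ?_ ?_
    · convert (dvd_form_sub_form d r hx₁ hya hm₁).add hk₁ using 1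
      ring
    · convert (dvd_form_sub_form d r hx₂ hyb hm₂).add hk₂ using 1
      ring

lemma locallySoluble_eight {d r : ℕ} (hr : Odd r) : LocallySoluble d r 8 := by
  intro k
  obtain ⟨x, hx⟩ : ∃ x : ℤ, Odd (x ^ 2 + d - k) := by
    rcases Int.even_or_odd ((d : ℤ) - k) with h | h
    · refine ⟨1, ?_⟩
      rw [show (1 : ℤ) ^ 2 + d - k = (d - k) + 1 by ring]
      exact h.add_one
    · exact ⟨0, by simpa using h⟩
  refine ⟨x, 1, x ^ 2 + d - k, isCoprime_one_left, ?_⟩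
  generalize hN : x ^ 2 + d - k = N at hx ⊢
  obtain ⟨s, rfl⟩ := hr
  have h8 : (8 : ℤ) ∣ N ^ 2 - 1 := Int.eight_dvd_sq_sub_one_of_odd hx
  have h : (8 : ℤ) ∣ (N ^ 2) ^ s - 1 ^ s := h8.trans (sub_dvd_pow_sub_pow _ _ s)
  obtain ⟨c, hc⟩ := (h.mul_left N).neg_right
  exact ⟨c, by push_cast; linear_combination hc + hN⟩

lemma exists_dvd_pow_sub {p r : ℕ} (hp : p.Prime) (hr : r.Prime) (h : ¬ r ∣ p - 1) (a : ℤ) :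
    ∃ m : ℤ, (p : ℤ) ∣ m ^ r - a := by
  have := Fact.mk hp
  suffices h : ∃ m : ZMod p, m ^ r = (a : ZMod p) by
    obtain ⟨m, hm⟩ := h
    refine ⟨m.val, ?_⟩
    rw [← ZMod.intCast_zmod_eq_zero_iff_dvd]
    push_cast
    rw [ZMod.natCast_zmod_val, hm, sub_self]
  by_cases ha : (a : ZMod p) = 0
  · exact ⟨0, by rw [ha, zero_pow hr.ne_zero]⟩
  · have hc : (Nat.card (ZMod p)ˣ).Coprime r := by
      rw [Nat.card_eq_fintype_card, ZMod.card_units_eq_totient, Nat.totient_prime hp]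
      exact ((Nat.Prime.coprime_iff_not_dvd hr).2 h).symm
    refine ⟨((powCoprime hc).symm (Units.mk0 _ ha) : (ZMod p)ˣ), ?_⟩
    have := (powCoprime hc).apply_symm_apply (Units.mk0 _ ha)
    rw [powCoprime_apply] at this
    rw [← Units.val_pow_eq_pow_val, this, Units.val_mk0]

lemma locallySoluble_prime_pow_of_dvd {d r p : ℕ} (hp : p.Prime) (hp2 : p ≠ 2) (hr : r.Prime)
    (h : ¬ r ∣ p - 1) (hd : p ∣ d) (e : ℕ) : LocallySoluble d r (p ^ (e + 1)) := by
  intro k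
  obtain ⟨m, hm⟩ := exists_dvd_pow_sub hp hr h (1 - k)
  set N := k + m ^ r - d with hN
  have hN1 : (p : ℤ) ∣ N - 1 := by
    have hd' : (p : ℤ) ∣ d := by exact_mod_cast hd
    obtain ⟨c, hc⟩ := hm.sub hd'
    exact ⟨c, by linear_combination hc + hN⟩
  have hpow := dvd_sub_pow_of_dvd_sub hN1 e
  obtain ⟨s, hs⟩ := (hp.odd_of_ne_two hp2).pow (n := e)
  refine ⟨N ^ (s + 1), 1, m, isCoprime_one_left, ?_⟩
  rw [one_pow] at hpow
  push_cast
  rw [hs] at hpow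
  obtain ⟨c, hc⟩ := hpow.mul_left N
  exact ⟨c, by linear_combination hc + hN⟩

lemma locallySoluble_prime_of_not_dvd_sub_one {d r p : ℕ} (hp : p.Prime) (hr : r.Prime)
    (h : ¬ r ∣ p - 1) : LocallySoluble d r p := by
  intro k
  obtain ⟨m, hm⟩ := exists_dvd_pow_sub hp hr h (d - k)
  refine ⟨0, 1, m, isCoprime_one_left, ?_⟩
  obtain ⟨c, hc⟩ := hm
  exact ⟨-c, by rw [zero_pow two_ne_zero]; linear_combination -hc⟩

lemma exists_sq_add_mul_sq_eq {p : ℕ} [Fact p.Prime] (hp5 : 5 ≤ p) {d N : ZMod p} (hd : d ≠ 0)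
    (hN : N ≠ 0) : ∃ x y : ZMod p, y ≠ 0 ∧ x ^ 2 + d * y ^ 2 = N := by
  have hp : p.Prime := Fact.out
  obtain ⟨x, y, hxy⟩ : ∃ x y : ZMod p, x ^ 2 + d * y ^ 2 = N := by
    obtain ⟨x, y, h⟩ := FiniteField.exists_root_sum_quadratic (R := ZMod p)
      (f := Polynomial.X ^ 2) (g := Polynomial.C d * Polynomial.X ^ 2 + Polynomial.C 0 *
        Polynomial.X + Polynomial.C (-N)) (by simp) (Polynomial.degree_quadratic hd)
      (by rw [ZMod.card]; exact (hp.odd_of_ne_two (by omega)).elim fun s hs => by omega)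
    refine ⟨x, y, ?_⟩
    simp at h
    linear_combination h
  by_cases hy : y = 0
  swap
  · exact ⟨x, y, hy, hxy⟩
  have hx : x ≠ 0 := by
    rintro rfl
    apply hN
    rw [← hxy, hy]; ring
  have h2 : (2 : ZMod p) ≠ 0 := by
    have : ((2 : ℕ) : ZMod p) ≠ 0 := by
      rw [Ne, ZMod.natCast_eq_zero_iff]
      exact fun h => by have := Nat.le_of_dvd (by norm_num) h; omega
    exact_mod_cast this
  have h3 : (3 : ZMod p) ≠ 0 := by
    have : ((3 : ℕ) : ZMod p) ≠ 0 := by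
      rw [Ne, ZMod.natCast_eq_zero_iff]
      exact fun h => by have := Nat.le_of_dvd (by norm_num) h; omega
    exact_mod_cast this
  obtain ⟨t, ht, ht'⟩ : ∃ t : ZMod p, t ≠ 0 ∧ 1 + d * t ^ 2 ≠ 0 := by
    by_cases h1 : 1 + d * 1 ^ 2 = 0
    · refine ⟨2, h2, fun h => ?_⟩
      have : 3 * d = 0 := by linear_combination h - h1
      exact (mul_ne_zero h3 hd) this
    · exact ⟨1, one_ne_zero, h1⟩
  refine ⟨x * (1 - d * t ^ 2) / (1 + d * t ^ 2), 2 * x * t / (1 + d * t ^ 2),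
    div_ne_zero (mul_ne_zero (mul_ne_zero h2 hx) ht) ht', ?_⟩
  have hxN : N = x ^ 2 := by rw [← hxy, hy]; ring
  rw [hxN]
  field_simp
  ring

lemma locallySoluble_prime_of_not_dvd {d r p : ℕ} (hp : p.Prime) (hp5 : 5 ≤ p) (hr : r ≠ 0)
    (hd : ¬ p ∣ d) : LocallySoluble d r p := by
  intro k
  have := Fact.mk hp
  have hd' : (d : ZMod p) ≠ 0 := by rwa [Ne, ZMod.natCast_eq_zero_iff]
  obtain ⟨m, hm⟩ : ∃ m : ℤ, ((k : ZMod p) + (m : ZMod p) ^ r) ≠ 0 := by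
    by_cases h : (k : ZMod p) = 0
    · exact ⟨1, by simp [h]⟩
    · exact ⟨0, by simpa [hr] using h⟩
  obtain ⟨x, y, hy, hxy⟩ := exists_sq_add_mul_sq_eq hp5 hd' hm
  refine ⟨x.val, y.val, m, ?_, ?_⟩
  · rw [Nat.isCoprime_iff_coprime, Nat.coprime_comm, hp.coprime_iff_not_dvd,
      ← ZMod.natCast_eq_zero_iff, ZMod.natCast_zmod_val]
    exact hy
  · rw [← ZMod.intCast_zmod_eq_zero_iff_dvd]
    push_cast
    rw [ZMod.natCast_zmod_val, ZMod.natCast_zmod_val, hxy]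
    ring

lemma locallySoluble_four_mul {d r q : ℕ} (hd : Odd d) (hr : r.Prime) (hr3 : 3 ≤ r)
    (hp : ∀ p : ℕ, p.Prime → p ∣ d → ¬ r ∣ p - 1) (hq : Squarefree q) :
    LocallySoluble d r (4 * q * d) := by
  suffices h : ∀ n, n ∣ 4 * q * d → LocallySoluble d r n from h _ dvd_rfl
  intro n
  induction n using Nat.recOnPosPrimePosCoprime with
  | zero =>
    intro h
    have h0 := Nat.eq_zero_of_zero_dvd h
    have := hq.ne_zero
    have := hd.pos
    simp_all
  | one => intro _ k; exact ⟨0, 1, 0, isCoprime_one_left, by simp⟩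
  | prime_pow p e hpp he =>
    intro h
    obtain ⟨e, rfl⟩ := Nat.exists_eq_succ_of_ne_zero he.ne'
    rw [Nat.succ_eq_add_one] at h ⊢
    by_cases hp2 : p = 2
    · subst hp2
      have h1 : 2 ^ (e + 1) ∣ 4 * q :=
        ((Nat.coprime_two_left.2 hd).pow_left _).dvd_of_dvd_mul_right h
      have he3 : e + 1 ≤ 3 := by
        by_contra hlt
        have h2 : 4 * (2 * 2) ∣ 4 * q := (pow_dvd_pow 2 (show 4 ≤ e + 1 by omega)).trans h1
        have h3 := hq 2 (Nat.dvd_of_mul_dvd_mul_left (by norm_num) h2)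
        simp at h3
      exact (locallySoluble_eight (hr.odd_of_ne_two (by omega))).of_dvd
        (pow_dvd_pow 2 he3)
    · by_cases hpd : p ∣ d
      · exact locallySoluble_prime_pow_of_dvd hpp hp2 hr (hp p hpp hpd) hpd e
      · have hodd := hpp.odd_of_ne_two hp2
        have h1 : p ^ (e + 1) ∣ 4 * q :=
          (((Nat.Prime.coprime_iff_not_dvd hpp).2 hpd).pow_left _).dvd_of_dvd_mul_right h
        have h4 : Nat.Coprime p 4 := by
          rw [show (4 : ℕ) = 2 ^ 2 by norm_num]
          exact (Nat.coprime_two_right.2 hodd).pow_right 2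
        have h2 : p ^ (e + 1) ∣ q := (h4.pow_left _).dvd_of_dvd_mul_left h1
        have he0 : e = 0 := by
          by_contra hlt
          have h3 : p * p ∣ q := by
            rw [← sq]; exact (pow_dvd_pow p (show 2 ≤ e + 1 by omega)).trans h2
          exact hpp.one_lt.ne' (Nat.isUnit_iff.1 (hq p h3))
        subst he0
        rw [zero_add, pow_one]
        by_cases hp5 : 5 ≤ p
        · exact locallySoluble_prime_of_not_dvd hpp hp5 hr.ne_zero hpd
        · refine locallySoluble_prime_of_not_dvd_sub_one hpp hr fun h => ?_
          have := hpp.two_le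
          have := Nat.le_of_dvd (by omega) h
          obtain ⟨s, hs⟩ := hodd
          omega
  | coprime a b ha hb hab iha ihb =>
    intro h
    exact (iha (dvd_of_mul_right_dvd h)).mul (ihb (dvd_of_mul_left_dvd h)) hab

/-- The integers of the form `n₁² + d n₂² + n₃ ^ r`. -/
def IsRepresented (d r : ℕ) (k : ℤ) : Prop :=
  ∃ n₁ n₂ n₃ : ℤ, k = n₁ ^ 2 + d * n₂ ^ 2 + n₃ ^ r

lemma LocallySoluble.exists_reduced {d r q : ℕ} (hq : 0 < q) (hd : 0 < d)
    (h : LocallySoluble d r (4 * q * d)) (k : ℤ) :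
    ∃ x y m : ℤ, (0 ≤ x ∧ x < 2 * q * d) ∧ (0 ≤ y ∧ y < 2 * q) ∧ (0 ≤ m ∧ m < 4 * q * d) ∧
      IsCoprime y (q : ℤ) ∧ (4 * q * d : ℤ) ∣ x ^ 2 + d * y ^ 2 - m ^ r - k := by
  obtain ⟨x, y, m, hy, hk⟩ := h k
  push_cast at hy hk
  have hq' : (0 : ℤ) < q := by exact_mod_cast hq
  have hd' : (0 : ℤ) < d := by exact_mod_cast hd
  refine ⟨x % (2 * q * d), y % (2 * q), m % (4 * q * d),
    ⟨Int.emod_nonneg _ (by positivity), Int.emod_lt_of_pos _ (by positivity)⟩,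
    ⟨Int.emod_nonneg _ (by positivity), Int.emod_lt_of_pos _ (by positivity)⟩,
    ⟨Int.emod_nonneg _ (by positivity), Int.emod_lt_of_pos _ (by positivity)⟩, ?_, ?_⟩
  · have hyq : IsCoprime y (q : ℤ) := hy.of_isCoprime_of_dvd_right ⟨4 * d, by ring⟩
    refine hyq.of_dvd_sub ⟨-2 * (y / (2 * q)), ?_⟩
    linear_combination Int.emod_add_mul_ediv y (2 * q)
  · have hx := Int.emod_add_mul_ediv x (2 * q * d)
    have hy' := Int.emod_add_mul_ediv y (2 * q)
    have hm := Int.emod_add_mul_ediv m (4 * q * d)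
    set x' := x % (2 * q * d)
    set y' := y % (2 * q)
    set m' := m % (4 * q * d)
    set s := x / (2 * q * d)
    set t := y / (2 * q)
    obtain ⟨u, hu⟩ : (4 * q * d : ℤ) ∣ m ^ r - m' ^ r :=
      (Dvd.intro (m / (4 * q * d)) (by linarith)).trans (sub_dvd_pow_sub_pow m m' r)
    obtain ⟨c, hc⟩ := hk
    refine ⟨c + u - s * x' - q * d * s ^ 2 - t * y' - q * t ^ 2, ?_⟩
    rw [← hx, ← hy'] at hc
    linear_combination hc + hu

lemma exists_quotient_of_pow_sub (r D M P : ℕ) (hr : r ≠ 0) (hD : 0 < D) (m₀ : ℤ) (hm₀ : 0 ≤ m₀)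
    (hm₀' : m₀ < D) (hP : (D * M) ^ r ≤ P) :
    ∃ C : ℕ → ℤ, (∀ i, D * C i = (m₀ + D * i) ^ r - m₀ ^ r) ∧
      (∀ i < M, (m₀ + D * i) ^ r ≤ P) ∧
      (∀ i < M, ∀ j < M, |C i - C j| ≤ ((D * M) ^ r : ℕ)) ∧
      (∀ i < M, ∀ j < M, i ≠ j → C i ≠ C j) := by
  have hD' : (0 : ℤ) < D := by exact_mod_cast hD
  have hdvd : ∀ i : ℕ, (D : ℤ) ∣ (m₀ + D * i) ^ r - m₀ ^ r := fun i =>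
    (Dvd.intro (i : ℤ) (by ring)).trans (sub_dvd_pow_sub_pow _ _ r)
  choose C hC using hdvd
  have hle : ∀ i < M, (m₀ + D * i) ^ r ≤ ((D * M) ^ r : ℕ) := by
    intro i hi
    push_cast
    refine pow_le_pow_left₀ (by positivity) ?_ r
    have : (i : ℤ) + 1 ≤ M := by exact_mod_cast hi
    nlinarith
  refine ⟨C, fun i => (hC i).symm, fun i hi => (hle i hi).trans (by exact_mod_cast hP), ?_, ?_⟩
  · intro i hi j hj
    have h1 : |(D : ℤ) * (C i - C j)| ≤ ((D * M) ^ r : ℕ) := by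
      rw [show (D : ℤ) * (C i - C j) = (m₀ + D * i) ^ r - (m₀ + D * j) ^ r by
        linear_combination hC j - hC i]
      have := hle i hi
      have := hle j hj
      have : 0 ≤ (m₀ + D * i) ^ r := by positivity
      have : 0 ≤ (m₀ + D * j) ^ r := by positivity
      rw [abs_le]
      constructor <;> linarith
    rw [abs_mul, abs_of_pos hD'] at h1
    have : 0 ≤ |C i - C j| := abs_nonneg _
    nlinarith
  · intro i hi j hj hij h
    have h1 : (m₀ + D * i) ^ r = (m₀ + D * j) ^ r := by
      linear_combination hC i - hC j + D * h
    have h2 := (pow_left_inj₀ (by positivity) (by positivity) hr).1 h1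
    have h3 : (D : ℤ) * i = D * j := by linarith
    exact hij (by exact_mod_cast mul_left_cancel₀ hD'.ne' h3)

lemma exists_represented_finset {d r q κ P M Z k : ℕ} (hq : 0 < q) (hd : 0 < d) (hκ : 2 ≤ κ)
    (hP : 0 < P) (hM : 0 < M) (hZ : 0 < Z) (hr : Odd r)
    (h2q : 2 ∣ q) (hdq : ∀ p : ℕ, p.Prime → p ∣ d → p ∣ q)
    (hZq : ∀ p : ℕ, p.Prime → p ≤ Z → p ∣ q)
    (hsol : LocallySoluble d r (4 * q * d)) (hPM : (4 * q * d * M) ^ r ≤ P)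
    (hk : (4 * q * d * M) ^ r ≤ Z ^ k) (δ : ℝ)
    (hδ : (κ : ℝ) * (κ + 4) / (κ ^ 2 - 3) * (1 + 1 / Z) ^ k +
      (κ * (κ + 4) / (κ ^ 2 - 3) * (1 + Real.log P) + 4 * q ^ 2 * d * κ ^ 4) / M ≤ 1 + δ)
    (k₀ : ℤ) :
    ∃ R : Finset ℤ, (∀ n ∈ R, IsRepresented d r n ∧ (4 * q * d : ℤ) ∣ n - k₀ ∧
      (4 * q ^ 2 * d * κ ^ 4 * P : ℤ) ^ 2 ≤ n ∧
      n < (4 * q ^ 2 * d * κ ^ 3 * (κ + 1) * P) ^ 2 + d * (2 * q * (κ ^ 2 + 1) * P) ^ 2) ∧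
      8 * (q : ℝ) ^ 3 * d * κ ^ 7 * P ^ 2 ≤ (1 + δ) * R.card := by
  obtain ⟨x₀, y₀, m₀, ⟨hx, hx'⟩, ⟨hy, hy'⟩, ⟨hm, hm'⟩, hyq, hk₀⟩ :=
    hsol.exists_reduced hq hd k₀
  obtain ⟨C, hC, hCP, hCle, hCne⟩ := exists_quotient_of_pow_sub r (4 * q * d) M P
    hr.pos.ne' (by positivity) m₀ hm (by exact_mod_cast hm') hPM
  push_cast at hC hCP
  have hq' : (0 : ℤ) < q := by exact_mod_cast hq
  have hd' : (0 : ℤ) < d := by exact_mod_cast hd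
  have hP' : (1 : ℤ) ≤ P := by exact_mod_cast hP
  have hκ' : (2 : ℤ) ≤ κ := by exact_mod_cast hκ
  have hD0 : (4 * q * d : ℤ) ≠ 0 := by positivity
  set S := (box q κ P M).image (boxValue q d x₀ y₀ C) with hS
  have hinj : Function.Injective
      (fun v : ℤ => x₀ ^ 2 + d * y₀ ^ 2 - m₀ ^ r + 4 * q * d * v) := by
    intro v w hvw
    exact mul_left_cancel₀ hD0 (by simpa using hvw)
  refine ⟨S.image (fun v : ℤ => x₀ ^ 2 + d * y₀ ^ 2 - m₀ ^ r + 4 * q * d * v), ?_, ?_⟩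
  · intro n hn
    rw [hS, Finset.image_image, Finset.mem_image] at hn
    obtain ⟨⟨⟨ξ, η⟩, i⟩, hz, rfl⟩ := hn
    simp only [box, Finset.mem_product, Finset.mem_Ico, Finset.mem_range] at hz
    obtain ⟨⟨⟨hξ, hξ'⟩, hη, hη'⟩, hi⟩ := hz
    simp only [Function.comp_apply, boxValue]
    have hform : x₀ ^ 2 + d * y₀ ^ 2 - m₀ ^ r + 4 * q * d *
        (x₀ * ξ + q * d * ξ ^ 2 + (y₀ * η + q * η ^ 2) - C i) =
        (x₀ + 2 * q * d * ξ) ^ 2 + d * (y₀ + 2 * q * η) ^ 2 - (m₀ + 4 * q * d * i) ^ r := by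
      linear_combination -(hC i)
    refine ⟨⟨x₀ + 2 * q * d * ξ, y₀ + 2 * q * η, -(m₀ + 4 * q * d * i), ?_⟩, ?_, ?_, ?_⟩
    · rw [hform, hr.neg_pow]; ring
    · obtain ⟨c, hc⟩ := hk₀
      exact ⟨c + (x₀ * ξ + q * d * ξ ^ 2 + (y₀ * η + q * η ^ 2) - C i), by
        linear_combination hc⟩
    · rw [hform]
      have h1 : (4 * q ^ 2 * d * κ ^ 4 * P : ℤ) ≤ x₀ + 2 * q * d * ξ := by
        have := mul_le_mul_of_nonneg_left hξ (show (0 : ℤ) ≤ 2 * q * d by positivity)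
        linarith
      have h2 : (P : ℤ) ≤ y₀ + 2 * q * η := by
        have h3 : (1 : ℤ) ≤ 2 * q * κ ^ 2 := by
          have : (0 : ℤ) < 2 * q * κ ^ 2 := by positivity
          linarith
        have := mul_le_mul_of_nonneg_left hη (show (0 : ℤ) ≤ 2 * q by positivity)
        nlinarith
      have h3 : (4 * q ^ 2 * d * κ ^ 4 * P : ℤ) ^ 2 ≤ (x₀ + 2 * q * d * ξ) ^ 2 :=
        pow_le_pow_left₀ (by positivity) h1 2
      have h4 : (P : ℤ) ≤ d * (y₀ + 2 * q * η) ^ 2 := by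
        have h5 : (P : ℤ) * 1 ≤ (y₀ + 2 * q * η) * (y₀ + 2 * q * η) :=
          mul_le_mul h2 (hP'.trans h2) zero_le_one (by linarith)
        nlinarith
      have := hCP i hi
      linarith
    · rw [hform]
      have h0 : (0 : ℤ) ≤ κ ^ 2 * P := by positivity
      have h0' : (0 : ℤ) ≤ 2 * q * κ ^ 4 * P := by positivity
      have hξ0 : 0 ≤ ξ := by linarith
      have hη0 : 0 ≤ η := by linarith
      have h1 : x₀ + 2 * q * d * ξ < (4 * q ^ 2 * d * κ ^ 3 * (κ + 1) * P : ℤ) := by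
        have := mul_le_mul_of_nonneg_left (Int.add_one_le_of_lt hξ')
          (show (0 : ℤ) ≤ 2 * q * d by positivity)
        linarith
      have h2 : y₀ + 2 * q * η < (2 * q * (κ ^ 2 + 1) * P : ℤ) := by
        have := mul_le_mul_of_nonneg_left (Int.add_one_le_of_lt hη')
          (show (0 : ℤ) ≤ 2 * q by positivity)
        linarith
      have h3 := pow_lt_pow_left₀ h1 (by positivity) two_ne_zero
      have h4 := mul_le_mul_of_nonneg_left
        (pow_le_pow_left₀ (show 0 ≤ y₀ + 2 * q * η by positivity) h2.le 2) hd'.le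
      have h5 : 0 ≤ (m₀ + 4 * q * d * i) ^ r := by positivity
      linarith
  · rw [Finset.card_image_of_injective _ hinj]
    have hmain := card_box_sq_le q d κ P M hq hd hκ hP h2q hdq x₀ y₀ hx hx'.le hy hy'.le hyq C
      (fun i hi j hj => (hCle i hi j hj).trans (by exact_mod_cast hPM)) ((1 + 1 / Z) ^ k)
      (by positivity)
      (fun i hi j hj hij => ⟨hCne i hi j hj hij, recipSum_le_pow q P Z k hZ hZq _
        (sub_ne_zero.2 (hCne i hi j hj hij)) (by
          have := (hCle i hi j hj).trans (Int.ofNat_le.2 hk)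
          rw [Int.abs_eq_natAbs] at this
          exact_mod_cast this)⟩)
    rw [← hS] at hmain
    push_cast at hmain
    have hqR : (0 : ℝ) < q := by exact_mod_cast hq
    have hdR : (0 : ℝ) < d := by exact_mod_cast hd
    have hPR : (0 : ℝ) < P := by exact_mod_cast hP
    have hMR : (0 : ℝ) < M := by exact_mod_cast hM
    have hκR : (2 : ℝ) ≤ κ := by exact_mod_cast hκ
    have hκ3 : (0 : ℝ) < κ ^ 2 - 3 := by nlinarith
    set B : ℝ := (κ : ℝ) * (κ + 4) / (κ ^ 2 - 3) * (1 + 1 / Z) ^ k +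
      (κ * (κ + 4) / (κ ^ 2 - 3) * (1 + Real.log P) + 4 * q ^ 2 * d * κ ^ 4) / M with hB
    have hfac : (M : ℝ) ^ 2 * ((κ + 4) * (P : ℝ) ^ 2 / ((κ ^ 2 - 3) * (2 * q * d)) *
          (1 + 1 / Z) ^ k) +
        M * ((κ + 4) * (P : ℝ) ^ 2 / ((κ ^ 2 - 3) * (2 * q * d)) * (1 + Real.log P)
          + 2 * q * κ ^ 3 * P * P) = (M * P) ^ 2 / (2 * q * d * κ) * B := by
      rw [hB]
      generalize (1 + 1 / (Z : ℝ)) ^ k = h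
      field_simp
      ring
    rw [hfac] at hmain
    have hle : (2 * q * κ ^ 3 * P * P * M : ℝ) ^ 2 ≤
        (M * P) ^ 2 / (2 * q * d * κ) * ((1 + δ) * S.card) := by
      refine hmain.trans ?_
      have h1 : (S.card : ℝ) * B ≤ S.card * (1 + δ) :=
        mul_le_mul_of_nonneg_left hδ (by positivity)
      have h2 := mul_le_mul_of_nonneg_left h1
        (show (0 : ℝ) ≤ (M * P) ^ 2 / (2 * q * d * κ) by positivity)
      linarith
    have hpos : (0 : ℝ) < (M * P) ^ 2 / (2 * q * d * κ) := by positivity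
    refine le_of_mul_le_mul_left (le_trans (le_of_eq ?_) hle) hpos
    field_simp
    ring

open Classical in
lemma card_not_isRepresented_le {d r q κ P M Z k : ℕ} (hq : 0 < q) (hd : 0 < d) (hκ : 2 ≤ κ)
    (hP : 0 < P) (hM : 0 < M) (hZ : 0 < Z) (hr : Odd r)
    (h2q : 2 ∣ q) (hdq : ∀ p : ℕ, p.Prime → p ∣ d → p ∣ q)
    (hZq : ∀ p : ℕ, p.Prime → p ≤ Z → p ∣ q)
    (hsol : LocallySoluble d r (4 * q * d)) (hPM : (4 * q * d * M) ^ r ≤ P)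
    (hk : (4 * q * d * M) ^ r ≤ Z ^ k) (δ : ℝ) (hδ0 : 0 ≤ δ)
    (hδ : (κ : ℝ) * (κ + 4) / (κ ^ 2 - 3) * (1 + 1 / Z) ^ k +
      (κ * (κ + 4) / (κ ^ 2 - 3) * (1 + Real.log P) + 4 * q ^ 2 * d * κ ^ 4) / M ≤ 1 + δ)
    {lo hi : ℤ} (hlo : lo = (4 * q ^ 2 * d * κ ^ 4 * P : ℤ) ^ 2)
    (hhi : hi = (4 * q ^ 2 * d * κ ^ 3 * (κ + 1) * P : ℤ) ^ 2 +
      d * (2 * q * (κ ^ 2 + 1) * P) ^ 2) :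
    (((Finset.Ico lo hi).filter (fun n => ¬ IsRepresented d r n)).card : ℝ) ≤
      (1 / κ + δ) * (hi - lo : ℤ) := by
  set E := (Finset.Ico lo hi).filter (fun n => ¬ IsRepresented d r n) with hE
  set K : ℕ := (4 * q ^ 3 * d * κ ^ 6 * (2 * κ + 1) + q * (κ ^ 2 + 1) ^ 2) * P ^ 2 with hK
  set V : ℝ := 8 * (q : ℝ) ^ 3 * d * κ ^ 7 * P ^ 2 with hV
  have hqR : (1 : ℝ) ≤ q := by exact_mod_cast hq
  have hdR : (1 : ℝ) ≤ d := by exact_mod_cast hd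
  have hκR : (2 : ℝ) ≤ κ := by exact_mod_cast hκ
  have hD : (0 : ℤ) < 4 * q * d := by positivity
  have hhiK : hi = lo + K * (4 * q * d : ℤ) := by
    rw [hhi, hlo, hK]; push_cast; ring
  have hKV : V ≤ K := by
    rw [hV, hK]; push_cast
    have : (0 : ℝ) ≤ (4 * q ^ 3 * d * κ ^ 6 + q * (κ ^ 2 + 1) ^ 2) * P ^ 2 := by positivity
    nlinarith
  have hKV' : (K : ℝ) ≤ (1 + 1 / κ) * V := by
    have h1 : (1 + 1 / (κ : ℝ)) * V =
        (4 * q ^ 3 * d * κ ^ 6 * (2 * κ + 1) + 4 * q ^ 3 * d * κ ^ 6) * P ^ 2 := by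
      rw [hV]; field_simp; ring
    rw [h1, hK]; push_cast
    have h2 : ((κ : ℝ) ^ 2 + 1) ^ 2 ≤ 4 * κ ^ 6 := by
      have h3 : ((κ : ℝ) ^ 2 + 1) ^ 2 ≤ (2 * κ ^ 2) ^ 2 :=
        pow_le_pow_left₀ (by positivity) (by nlinarith) 2
      have h4 : (κ : ℝ) ^ 4 ≤ κ ^ 6 := pow_le_pow_right₀ (by linarith) (by norm_num)
      nlinarith
    have h5 : (q : ℝ) ≤ q ^ 3 * d := by
      have h6 : (q : ℝ) ^ 1 ≤ q ^ 3 := pow_le_pow_right₀ hqR (by norm_num)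
      have h7 : (q : ℝ) ^ 3 * 1 ≤ q ^ 3 * d := mul_le_mul_of_nonneg_left hdR (by positivity)
      linarith
    have h8 := mul_le_mul h5 h2 (by positivity) (by positivity)
    exact mul_le_mul_of_nonneg_right (by linarith) (by positivity)
  have hclass : ∀ j ∈ Finset.range (4 * q * d),
      ((E.filter (fun n => n % (4 * q * d : ℤ) = j)).card : ℝ) ≤ (1 / κ + δ) * V := by
    intro j _
    obtain ⟨R, hR, hRV⟩ := exists_represented_finset hq hd hκ hP hM hZ hr h2q hdq hZq hsol hPM hk
      δ hδ j
    set F := E.filter (fun n => n % (4 * q * d : ℤ) = j) with hF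
    have hdisj : Disjoint F R := by
      rw [Finset.disjoint_left]
      intro n hn hnR
      rw [hF, Finset.mem_filter, hE, Finset.mem_filter] at hn
      exact hn.1.2 (hR n hnR).1
    have hFR : ∀ n ∈ F ∪ R, (4 * q * d : ℤ) ∣ n - j ∧ lo ≤ n ∧ n < hi := by
      intro n hn
      rcases Finset.mem_union.1 hn with h | h
      · rw [hF, Finset.mem_filter, hE, Finset.mem_filter, Finset.mem_Ico] at h
        refine ⟨?_, h.1.1⟩
        rw [← h.2]
        exact Int.dvd_self_sub_emod
      · have := (hR n h).2
        rwa [← hlo, ← hhi] at this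
    have hcard : (F ∪ R).card ≤ K := by
      refine card_le_of_pairwise_dvd_sub _ lo (4 * q * d) K hD (fun n hn => ?_)
        (fun n hn m hm => ?_)
      · rw [← hhiK]; exact (hFR n hn).2
      · have := dvd_sub (hFR n hn).1 (hFR m hm).1
        rwa [sub_sub_sub_cancel_right] at this
    rw [Finset.card_union_of_disjoint hdisj] at hcard
    have hcard' : (F.card : ℝ) + R.card ≤ K := by exact_mod_cast hcard
    have hR0 : (0 : ℝ) ≤ R.card := by positivity
    have hV0 : 0 ≤ V := by positivity
    have hRV' : (1 - δ) * V ≤ R.card := by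
      rcases le_or_gt δ 1 with h | h
      · have := mul_le_mul_of_nonneg_left hRV (show 0 ≤ 1 - δ by linarith)
        nlinarith [mul_nonneg (sq_nonneg δ) hR0]
      · nlinarith
    linarith
  have hsum : E.card = ∑ j ∈ Finset.range (4 * q * d),
      (E.filter (fun n => n % (4 * q * d : ℤ) = j)).card := by
    rw [Finset.card_eq_sum_card_fiberwise (f := fun n => (n % (4 * q * d : ℤ)).toNat)
      (t := Finset.range (4 * q * d))]
    · refine Finset.sum_congr rfl fun j _ => ?_
      congr 1
      refine Finset.filter_congr fun n _ => ?_
      have := Int.emod_nonneg n hD.ne'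
      omega
    · intro n _
      have h1 := Int.emod_nonneg n hD.ne'
      have h2 := Int.emod_lt_of_pos n hD
      simp only [Finset.coe_range, Set.mem_Iio]
      zify
      rwa [Int.toNat_of_nonneg h1]
  rw [hsum]
  push_cast
  refine (Finset.sum_le_sum hclass).trans ?_
  rw [Finset.sum_const, Finset.card_range, nsmul_eq_mul, hhiK]
  push_cast
  have h1 : (0 : ℝ) ≤ (1 / κ + δ) * (4 * q * d) := by positivity
  have h2 := mul_le_mul_of_nonneg_left hKV h1
  linarith

open Filter in
lemma tendsto_nat_log_two_atTop : Tendsto (Nat.log 2) atTop atTop := by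
  refine tendsto_atTop.2 fun b => ?_
  filter_upwards [eventually_ge_atTop (2 ^ b)] with n hn
  exact Nat.le_log_of_pow_le one_lt_two hn

open Filter in
lemma tendsto_one_add_one_div_pow (r : ℕ) :
    Tendsto (fun Z : ℕ => (1 + 1 / (Z : ℝ)) ^ (12 * r * Z / Nat.log 2 Z + 1)) atTop (nhds 1) := by
  have hexp : Tendsto (fun Z : ℕ => Real.exp (12 * r / (Nat.log 2 Z : ℝ) + 1 / Z)) atTop
      (nhds 1) := by
    have h1 : Tendsto (fun Z : ℕ => 12 * r / (Nat.log 2 Z : ℝ)) atTop (nhds 0) :=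
      ((tendsto_natCast_atTop_atTop (R := ℝ)).comp tendsto_nat_log_two_atTop).const_div_atTop _
    have h2 := h1.add (tendsto_one_div_atTop_nhds_zero_nat (𝕜 := ℝ))
    have h3 := (Real.continuous_exp.tendsto _).comp h2
    simpa [Function.comp_def] using h3
  refine tendsto_of_tendsto_of_tendsto_of_le_of_le' tendsto_const_nhds hexp ?_ ?_
  · exact Eventually.of_forall fun Z => one_le_pow₀ (by simp)
  · filter_upwards [eventually_ge_atTop 2] with Z hZ
    have hZ0 : (0 : ℝ) < Z := by positivity
    have ha : (0 : ℝ) < Nat.log 2 Z := by exact_mod_cast Nat.log_pos one_lt_two hZ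
    have h1 : (1 + 1 / (Z : ℝ)) ^ (12 * r * Z / Nat.log 2 Z + 1) ≤
        Real.exp (1 / Z) ^ (12 * r * Z / Nat.log 2 Z + 1) :=
      pow_le_pow_left₀ (by positivity) (by linarith [Real.add_one_le_exp (1 / (Z : ℝ))]) _
    refine h1.trans ?_
    rw [← Real.exp_nat_mul, Real.exp_le_exp]
    have h2 : ((12 * r * Z / Nat.log 2 Z : ℕ) : ℝ) ≤ 12 * r * Z / Nat.log 2 Z := by
      refine Nat.cast_div_le.trans (le_of_eq ?_)
      push_cast; rfl
    push_cast
    calc (((12 * r * Z / Nat.log 2 Z : ℕ) : ℝ) + 1) * (1 / Z)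
        ≤ (12 * r * Z / Nat.log 2 Z + 1) * (1 / Z) := by gcongr
      _ = 12 * r / (Nat.log 2 Z : ℝ) + 1 / Z := by field_simp

open Filter in
lemma eventually_collision_bracket_le (d r κ : ℕ) (hκ : 6 ≤ κ) :
    ∀ᶠ Z : ℕ in atTop, ∀ P : ℕ, Real.log P ≤ 2 ^ Z →
      (κ : ℝ) * (κ + 4) / (κ ^ 2 - 3) * (1 + 1 / Z) ^ (12 * r * Z / Nat.log 2 Z + 1) +
      (κ * (κ + 4) / (κ ^ 2 - 3) * (1 + Real.log P) + 4 * (primorial Z : ℝ) ^ 2 * d * κ ^ 4) /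
        (2 ^ (6 * Z) : ℕ) ≤ 1 + 10 / κ := by
  have hκR : (6 : ℝ) ≤ κ := by exact_mod_cast hκ
  have hκ3 : (0 : ℝ) < κ ^ 2 - 3 := by nlinarith
  have hρ : (κ : ℝ) * (κ + 4) / (κ ^ 2 - 3) ≤ 1 + 5 / κ := by
    rw [div_le_iff₀ hκ3, show (1 + 5 / (κ : ℝ)) = (κ + 5) / κ by field_simp, div_mul_eq_mul_div,
      le_div_iff₀ (by positivity)]
    nlinarith
  have hρ2 : (κ : ℝ) * (κ + 4) / (κ ^ 2 - 3) ≤ 2 := by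
    have : 5 / (κ : ℝ) ≤ 1 := by rw [div_le_one (by positivity)]; linarith
    linarith
  have hρ0 : 0 ≤ (κ : ℝ) * (κ + 4) / (κ ^ 2 - 3) := by positivity
  have hlim : Tendsto (fun Z : ℕ => (1 + 5 / (κ : ℝ)) *
      (1 + 1 / (Z : ℝ)) ^ (12 * r * Z / Nat.log 2 Z + 1) + (4 + 4 * d * κ ^ 4) / (Z : ℝ)) atTop
      (nhds ((1 + 5 / (κ : ℝ)) * 1 + 0)) :=
    ((tendsto_one_add_one_div_pow r).const_mul _).add
      ((tendsto_natCast_atTop_atTop (R := ℝ)).const_div_atTop _)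
  have hlt : (1 + 5 / (κ : ℝ)) * 1 + 0 < 1 + 10 / κ := by
    have : 5 / (κ : ℝ) < 10 / κ := by gcongr; norm_num
    linarith
  filter_upwards [hlim.eventually_lt_const hlt, eventually_ge_atTop 1] with Z hZ hZ1 P hP
  refine le_trans (add_le_add (mul_le_mul_of_nonneg_right hρ (by positivity)) ?_) hZ.le
  set t : ℝ := 2 ^ Z with ht
  have htZ : (Z : ℝ) ≤ t := by
    rw [ht]; exact_mod_cast (Nat.lt_two_pow_self (n := Z)).le
  have ht1 : 1 ≤ t := one_le_pow₀ one_le_two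
  have hq : (primorial Z : ℝ) ≤ t ^ 2 := by
    have h : (primorial Z : ℝ) ≤ 4 ^ Z := by exact_mod_cast primorial_le_four_pow Z
    rwa [ht, ← pow_mul, mul_comm, pow_mul, show (2 : ℝ) ^ 2 = 4 by norm_num]
  have hM : ((2 ^ (6 * Z) : ℕ) : ℝ) = t ^ 6 := by
    push_cast; rw [ht, ← pow_mul, mul_comm]
  rw [hM, div_le_div_iff₀ (by positivity) (by positivity)]
  have h1 : (κ : ℝ) * (κ + 4) / (κ ^ 2 - 3) * (1 + Real.log P) ≤ 4 * t ^ 4 := by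
    have h3 : 1 + Real.log P ≤ 2 * t := by linarith
    have h4 := mul_le_mul_of_nonneg_left h3 hρ0
    have h5 : t ^ 1 ≤ t ^ 4 := pow_le_pow_right₀ ht1 (by norm_num)
    nlinarith
  have h2 : 4 * (primorial Z : ℝ) ^ 2 * d * κ ^ 4 ≤ 4 * (t ^ 2) ^ 2 * d * κ ^ 4 := by gcongr
  have h6 : (Z : ℝ) ≤ t ^ 2 := by nlinarith
  calc _ ≤ (4 * t ^ 4 + 4 * (t ^ 2) ^ 2 * d * κ ^ 4) * t ^ 2 := by gcongr
    _ = (4 + 4 * d * κ ^ 4) * t ^ 6 := by ring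

lemma four_mul_primorial_mul_le {d Z : ℕ} (hd : d ≤ Z) (hZ : 2 ≤ Z) :
    4 * primorial Z * d * 2 ^ (6 * Z) ≤ 2 ^ (12 * Z) := by
  have h1 : 4 ≤ 2 ^ Z := (pow_le_pow_right₀ one_le_two hZ : 2 ^ 2 ≤ 2 ^ Z)
  have h2 : primorial Z ≤ 2 ^ (2 * Z) := by
    rw [pow_mul]; exact primorial_le_four_pow Z
  have h3 : d ≤ 2 ^ Z := hd.trans Nat.lt_two_pow_self.le
  calc 4 * primorial Z * d * 2 ^ (6 * Z)
      ≤ 2 ^ Z * 2 ^ (2 * Z) * 2 ^ Z * 2 ^ (6 * Z) := by gcongr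
    _ = 2 ^ (10 * Z) := by rw [← pow_add, ← pow_add, ← pow_add]; congr 1; ring
    _ ≤ 2 ^ (12 * Z) := pow_le_pow_right₀ one_le_two (by omega)

lemma two_pow_le_pow_div_log (Z n : ℕ) (hZ : 2 ≤ Z) : 2 ^ n ≤ Z ^ (n / Nat.log 2 Z + 1) := by
  have ha := Nat.log_pos one_lt_two hZ
  calc 2 ^ n ≤ 2 ^ (Nat.log 2 Z * (n / Nat.log 2 Z + 1)) :=
        pow_le_pow_right₀ one_le_two (Nat.lt_mul_div_succ n ha).le
    _ = (2 ^ Nat.log 2 Z) ^ (n / Nat.log 2 Z + 1) := pow_mul _ _ _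
    _ ≤ Z ^ (n / Nat.log 2 Z + 1) :=
        pow_le_pow_left₀ (by positivity) (Nat.pow_log_le_self 2 (by omega)) _

lemma eventually_le_two_pow (a b : ℕ) : ∀ᶠ Z : ℕ in Filter.atTop, a * Z ≤ 2 ^ (Z - b) := by
  have h : Filter.Tendsto (fun n : ℕ => (n : ℝ) ^ 1 / 2 ^ n) Filter.atTop (nhds 0) :=
    tendsto_pow_const_div_const_pow_of_one_lt 1 one_lt_two
  have hpos : (0 : ℝ) < 1 / ((a + 1) * 2 ^ b) := by positivity
  filter_upwards [h.eventually_lt_const hpos, Filter.eventually_ge_atTop b] with Z hZ hb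
  obtain ⟨c, rfl⟩ := Nat.exists_eq_add_of_le hb
  rw [div_lt_div_iff₀ (by positivity) (by positivity), pow_add] at hZ
  rw [Nat.add_sub_cancel_left]
  have h2 : (0 : ℝ) < 2 ^ b := by positivity
  have h3 : ((b + c : ℕ) : ℝ) * (a + 1) < 2 ^ c := by
    refine lt_of_mul_lt_mul_right ?_ h2.le
    linarith
  have h4 : (b + c) * (a + 1) < 2 ^ c := by exact_mod_cast h3
  nlinarith

lemma window_size {a₀ a₁ P n : ℕ} (ha : a₀ + 1 ≤ a₁) (hP0 : 0 < P) (hP : 4 * a₁ ≤ P)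
    (hn : a₁ * (P - 1) ^ 2 < n) : a₁ * P ^ 2 + a₀ * P ^ 2 < 2 * n := by
  obtain ⟨s, rfl⟩ : ∃ s, P = s + 1 := ⟨P - 1, by omega⟩
  rw [Nat.add_sub_cancel] at hn
  have h1 : (a₀ + 1) * (s + 1) ^ 2 ≤ a₁ * (s + 1) ^ 2 := Nat.mul_le_mul_right _ ha
  have h2 : 4 * a₁ * (s + 1) ≤ (s + 1) * (s + 1) := Nat.mul_le_mul_right _ hP
  nlinarith

lemma window_top_le (d κ : ℕ) {q : ℕ} (hq : 0 < q) :
    (4 * q ^ 2 * d * κ ^ 3 * (κ + 1)) ^ 2 + d * (2 * q * (κ ^ 2 + 1)) ^ 2 ≤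
      ((4 * d * κ ^ 3 * (κ + 1)) ^ 2 + 4 * d * (κ ^ 2 + 1) ^ 2) * q ^ 4 := by
  have h1 : q ^ 2 ≤ q ^ 4 := pow_le_pow_right₀ hq (by norm_num)
  have h2 := Nat.mul_le_mul_left (4 * d * (κ ^ 2 + 1) ^ 2) h1
  linarith

lemma window_bottom_lt {d κ q : ℕ} (hd : 0 < d) (hq : 0 < q) :
    (4 * q ^ 2 * d * κ ^ 4) ^ 2 + 1 ≤
      (4 * q ^ 2 * d * κ ^ 3 * (κ + 1)) ^ 2 + d * (2 * q * (κ ^ 2 + 1)) ^ 2 := by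
  refine add_le_add (Nat.pow_le_pow_left ?_ 2) (Nat.succ_le_of_lt (by positivity))
  rw [pow_succ κ 3, ← mul_assoc]
  exact Nat.mul_le_mul_left _ (Nat.le_succ κ)

open Classical in
lemma exists_sparse_window {d r : ℕ} (hd : Odd d) (hr : r.Prime) (hr3 : 3 ≤ r)
    (hp : ∀ p : ℕ, p.Prime → p ∣ d → ¬ r ∣ p - 1) (κ : ℕ) (hκ : 6 ≤ κ) :
    ∃ n₀ : ℕ, ∀ n ≥ n₀, ∃ lo < n,
      (((Finset.Ico lo n).filter (fun k : ℕ => ¬ IsRepresented d r k)).card : ℝ) ≤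
        22 / κ * (n - lo) := by
  have hd0 : 0 < d := hd.pos
  have hrodd : Odd r := hr.odd_of_ne_two (by omega)
  set c : ℕ := (4 * d * κ ^ 3 * (κ + 1)) ^ 2 + 4 * d * (κ ^ 2 + 1) ^ 2 with hc
  have hZtendsto : Filter.Tendsto (fun n : ℕ => Nat.log 2 (Nat.log 2 n) + 1) Filter.atTop
      Filter.atTop :=
    (Filter.tendsto_add_atTop_nat 1).comp
      (tendsto_nat_log_two_atTop.comp tendsto_nat_log_two_atTop)
  have hev := hZtendsto.eventually ((eventually_collision_bracket_le d r κ hκ).and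
    ((eventually_le_two_pow (9 + 24 * r) 1).and
      (Filter.eventually_ge_atTop (max (max d c) 2))))
  obtain ⟨n₀, hn₀⟩ := Filter.eventually_atTop.1 (hev.and (Filter.eventually_ge_atTop 2))
  refine ⟨n₀, fun n hn => ?_⟩
  obtain ⟨⟨hbr, h2Z, hZmax⟩, hn2⟩ := hn₀ n hn
  set Z : ℕ := Nat.log 2 (Nat.log 2 n) + 1 with hZ
  have hZd : d ≤ Z := (le_max_left _ _).trans ((le_max_left _ _).trans hZmax)
  have hZc : c ≤ Z := (le_max_right _ _).trans ((le_max_left _ _).trans hZmax)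
  have hZ2 : 2 ≤ Z := (le_max_right _ _).trans hZmax
  have hlog0 : Nat.log 2 n ≠ 0 := (Nat.log_pos one_lt_two hn2).ne'
  have hnlt : n ≤ 2 ^ 2 ^ Z :=
    (Nat.lt_pow_succ_log_self one_lt_two n).le.trans
      (pow_le_pow_right₀ one_le_two (Nat.lt_pow_succ_log_self one_lt_two _))
  have hnge : 2 ^ 2 ^ (Z - 1) ≤ n := by
    rw [hZ, Nat.add_sub_cancel]
    exact (pow_le_pow_right₀ one_le_two (Nat.pow_log_le_self 2 hlog0)).trans
      (Nat.pow_log_le_self 2 (by omega))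
  set q := primorial Z with hq
  have hq0 : 0 < q := primorial_pos Z
  have hqdvd : ∀ p : ℕ, p.Prime → p ≤ Z → p ∣ q := fun p hp hle => hp.dvd_primorial_iff.2 hle
  set a₀ : ℕ := (4 * q ^ 2 * d * κ ^ 4) ^ 2 with ha₀
  set a₁ : ℕ := (4 * q ^ 2 * d * κ ^ 3 * (κ + 1)) ^ 2 + d * (2 * q * (κ ^ 2 + 1)) ^ 2 with ha₁
  have ha₁pos : 0 < a₁ := by positivity
  have ha₀₁ : a₀ + 1 ≤ a₁ := window_bottom_lt hd0 hq0
  have ha₁le : a₁ ≤ 2 ^ (9 * Z) := by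
    have h2 : q ≤ 2 ^ (2 * Z) := by
      rw [pow_mul]; exact primorial_le_four_pow Z
    calc a₁ ≤ c * q ^ 4 := window_top_le d κ hq0
      _ ≤ 2 ^ Z * (2 ^ (2 * Z)) ^ 4 :=
        Nat.mul_le_mul (hZc.trans Nat.lt_two_pow_self.le) (Nat.pow_le_pow_left h2 4)
      _ = 2 ^ (9 * Z) := by rw [← pow_mul, ← pow_add]; congr 1; ring
  have hna : n ≤ a₁ * n ^ 2 :=
    (Nat.le_self_pow two_ne_zero n).trans (Nat.le_mul_of_pos_left _ ha₁pos)
  have hex : ∃ P : ℕ, n ≤ a₁ * P ^ 2 := ⟨n, hna⟩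
  set P := Nat.find hex with hPdef
  have hnP : n ≤ a₁ * P ^ 2 := Nat.find_spec hex
  have hPn : P ≤ n := Nat.find_min' hex hna
  have hPbig : 2 ^ (12 * r * Z) ≤ P := by
    by_contra hlt
    have h1 : P ^ 2 < (2 ^ (12 * r * Z)) ^ 2 := Nat.pow_lt_pow_left (by omega) two_ne_zero
    have h2 : a₁ * P ^ 2 < 2 ^ (9 * Z) * (2 ^ (12 * r * Z)) ^ 2 :=
      Nat.mul_lt_mul_of_le_of_lt ha₁le h1 (by positivity)
    rw [← pow_mul, ← pow_add] at h2
    have h3 : 2 ^ (9 * Z + 12 * r * Z * 2) ≤ 2 ^ 2 ^ (Z - 1) :=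
      pow_le_pow_right₀ one_le_two (le_trans (le_of_eq (by ring)) h2Z)
    omega
  have hP0 : 0 < P := lt_of_lt_of_le (by positivity) hPbig
  have h4a : 4 * a₁ ≤ P := by
    calc 4 * a₁ ≤ 2 ^ 2 * 2 ^ (9 * Z) := Nat.mul_le_mul_left 4 ha₁le
      _ = 2 ^ (2 + 9 * Z) := (pow_add _ _ _).symm
      _ ≤ 2 ^ (12 * r * Z) := pow_le_pow_right₀ one_le_two (by
        have := Nat.mul_le_mul_right Z hr3
        linarith)
      _ ≤ P := hPbig
  have hPmin : a₁ * (P - 1) ^ 2 < n := not_le.1 (Nat.find_min hex (by omega))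
  have hlogP : Real.log P ≤ 2 ^ Z := by
    have h1 : (P : ℝ) ≤ 2 ^ 2 ^ Z := by exact_mod_cast hPn.trans hnlt
    have h2 := Real.log_le_log (by exact_mod_cast hP0) h1
    rw [Real.log_pow] at h2
    push_cast at h2
    have h3 : Real.log 2 ≤ 1 := by linarith [Real.log_two_lt_d9]
    have h4 : (0 : ℝ) ≤ 2 ^ Z := by positivity
    exact h2.trans (mul_le_of_le_one_right h4 h3)
  have hDM : (4 * q * d * 2 ^ (6 * Z)) ^ r ≤ 2 ^ (12 * r * Z) := by
    calc (4 * q * d * 2 ^ (6 * Z)) ^ r ≤ (2 ^ (12 * Z)) ^ r :=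
          Nat.pow_le_pow_left (four_mul_primorial_mul_le hZd hZ2) r
      _ = 2 ^ (12 * r * Z) := by rw [← pow_mul]; congr 1; ring
  have hmain := card_not_isRepresented_le (d := d) (r := r) (q := q) (κ := κ) (P := P)
    (M := 2 ^ (6 * Z)) (Z := Z) (k := 12 * r * Z / Nat.log 2 Z + 1) hq0 hd0 (by omega) hP0
    (by positivity) (by omega) hrodd (hqdvd 2 Nat.prime_two hZ2)
    (fun p hpp hpd => hqdvd p hpp ((Nat.le_of_dvd hd0 hpd).trans hZd)) hqdvd
    (locallySoluble_four_mul hd hr hr3 hp (squarefree_primorial Z)) (hDM.trans hPbig)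
    (hDM.trans (two_pow_le_pow_div_log Z _ hZ2)) (10 / κ) (by positivity) (hbr P hlogP)
    (lo := ((a₀ * P ^ 2 : ℕ) : ℤ)) (hi := ((a₁ * P ^ 2 : ℕ) : ℤ))
    (by rw [ha₀]; push_cast; ring) (by rw [ha₁]; push_cast; ring)
  have hsize := window_size ha₀₁ hP0 h4a hPmin
  have hκR : (0 : ℝ) < κ := by positivity
  refine ⟨a₀ * P ^ 2, ?_, ?_⟩
  · have := Nat.mul_le_mul_right (P ^ 2) ((Nat.le_succ a₀).trans ha₀₁)
    omega
  have hcard : ((Finset.Ico (a₀ * P ^ 2) n).filter (fun k : ℕ => ¬ IsRepresented d r k)).card ≤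
      ((Finset.Ico ((a₀ * P ^ 2 : ℕ) : ℤ) ((a₁ * P ^ 2 : ℕ) : ℤ)).filter
        (fun k => ¬ IsRepresented d r k)).card := by
    refine Finset.card_le_card_of_injOn (fun k : ℕ => (k : ℤ)) ?_
      (Nat.cast_injective.injOn)
    intro k hk
    rw [Finset.mem_coe, Finset.mem_filter, Finset.mem_Ico] at hk ⊢
    exact ⟨⟨Int.ofNat_le.2 hk.1.1, Int.ofNat_lt.2 (hk.1.2.trans_le hnP)⟩, hk.2⟩
  have hsizeR : (a₁ * P ^ 2 : ℝ) + a₀ * P ^ 2 ≤ 2 * n := by exact_mod_cast hsize.le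
  calc _ ≤ (1 / (κ : ℝ) + 10 / κ) * (((a₁ * P ^ 2 : ℕ) : ℤ) - ((a₀ * P ^ 2 : ℕ) : ℤ) : ℤ) :=
        le_trans (by exact_mod_cast hcard) hmain
    _ = 11 / κ * ((a₁ * P ^ 2 : ℝ) - a₀ * P ^ 2) := by push_cast; ring
    _ ≤ 11 / κ * (2 * (n - a₀ * P ^ 2)) := by gcongr; linarith
    _ = 22 / κ * (n - (a₀ * P ^ 2 : ℕ)) := by push_cast; ring

lemma card_filter_range_le_of_windows {Q : ℕ → Prop} [DecidablePred Q] {ε : ℝ} (hε : 0 ≤ ε) {n₀ : ℕ}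
    (h : ∀ n ≥ n₀, ∃ lo < n, (((Finset.Ico lo n).filter Q).card : ℝ) ≤ ε * (n - lo)) (n : ℕ) :
    (((Finset.range n).filter Q).card : ℝ) ≤ n₀ + ε * n := by
  induction n using Nat.strong_induction_on with
  | _ n ih =>
    rcases lt_or_ge n n₀ with hn | hn
    · have h1 : ((Finset.range n).filter Q).card ≤ n :=
        (Finset.card_filter_le _ _).trans (Finset.card_range n).le
      have h2 : (((Finset.range n).filter Q).card : ℝ) ≤ n₀ := by exact_mod_cast h1.trans hn.le
      have h3 : 0 ≤ ε * n := by positivity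
      linarith
    · obtain ⟨lo, hlo, hcard⟩ := h n hn
      have h1 : ((Finset.range n).filter Q).card ≤
          ((Finset.range lo).filter Q).card + ((Finset.Ico lo n).filter Q).card := by
        refine le_trans (Finset.card_le_card ?_) (Finset.card_union_le _ _)
        intro k hk
        simp only [Finset.mem_union, Finset.mem_filter, Finset.mem_range, Finset.mem_Ico] at hk ⊢
        have := le_or_gt lo k
        tauto
      have h2 : (((Finset.range n).filter Q).card : ℝ) ≤
          ((Finset.range lo).filter Q).card + ((Finset.Ico lo n).filter Q).card := by
        exact_mod_cast h1
      have := ih lo hlo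
      linarith

open Classical Filter in
lemma tendsto_ncard_div_of_windows {Q : ℕ → Prop}
    (h : ∀ ε > (0 : ℝ), ∃ n₀ : ℕ, ∀ n ≥ n₀, ∃ lo < n,
      (((Finset.Ico lo n).filter (fun k => ¬ Q k)).card : ℝ) ≤ ε * (n - lo)) :
    Tendsto (fun N : ℕ => ({k : ℕ | 1 ≤ k ∧ k ≤ N ∧ Q k}.ncard : ℝ) / N) atTop (nhds 1) := by
  have hcard : ∀ N : ℕ, {k : ℕ | 1 ≤ k ∧ k ≤ N ∧ Q k}.ncard +
      ((Finset.Icc 1 N).filter (fun k => ¬ Q k)).card = N := by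
    intro N
    have h1 : {k : ℕ | 1 ≤ k ∧ k ≤ N ∧ Q k} = ((Finset.Icc 1 N).filter Q : Finset ℕ) := by
      ext k
      simp [and_assoc]
    rw [h1, Set.ncard_coe_finset, Finset.card_filter_add_card_filter_not, Nat.card_Icc,
      Nat.add_sub_cancel]
  rw [Metric.tendsto_atTop]
  intro ε hε
  obtain ⟨n₀, hn₀⟩ := h (ε / 4) (by positivity)
  obtain ⟨N₀, hN₀⟩ := exists_nat_gt ((n₀ : ℝ) / (ε / 4))
  refine ⟨N₀ + 1, fun N hN => ?_⟩
  have hN1 : (1 : ℝ) ≤ N := by exact_mod_cast (Nat.le_add_left 1 N₀).trans hN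
  have hNN₀ : (N₀ : ℝ) ≤ N := by exact_mod_cast (Nat.le_add_right N₀ 1).trans hN
  have hE := card_filter_range_le_of_windows (by positivity) hn₀ (N + 1)
  have hsub : ((Finset.Icc 1 N).filter (fun k => ¬ Q k)).card ≤
      ((Finset.range (N + 1)).filter (fun k => ¬ Q k)).card := by
    refine Finset.card_le_card (Finset.filter_subset_filter _ fun k hk => ?_)
    rw [Finset.mem_Icc] at hk
    exact Finset.mem_range.2 (Nat.lt_succ_of_le hk.2)
  have hsub' : (((Finset.Icc 1 N).filter (fun k => ¬ Q k)).card : ℝ) ≤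
      ((Finset.range (N + 1)).filter (fun k => ¬ Q k)).card := by exact_mod_cast hsub
  have hcardR : ({k : ℕ | 1 ≤ k ∧ k ≤ N ∧ Q k}.ncard : ℝ) +
      ((Finset.Icc 1 N).filter (fun k => ¬ Q k)).card = N := by exact_mod_cast hcard N
  have hn₀N : (n₀ : ℝ) < ε / 4 * N := by
    rw [div_lt_iff₀' (by positivity)] at hN₀
    exact hN₀.trans_le (mul_le_mul_of_nonneg_left hNN₀ (by positivity))
  push_cast at hE
  rw [Real.dist_eq, div_sub_one (by linarith), abs_div, abs_of_pos (by linarith : (0 : ℝ) < N),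
    div_lt_iff₀ (by linarith), abs_lt]
  have h0 : (0 : ℝ) ≤ ((Finset.Icc 1 N).filter (fun k => ¬ Q k)).card := by positivity
  have hεN : ε * 1 ≤ ε * N := mul_le_mul_of_nonneg_left hN1 hε.le
  constructor <;> linarith

open Filter

/-- Let `ℒ = {3, 7, 11, 15, 19, 35, 43, 51, 67, 91, 115, 123, 163, 187, 235, 267, 403, 427}`,
let `d ∈ ℒ` and let `r ≥ 3` be a prime such that `p ≢ 1 (mod r)` for all primes `p ∣ d`. Then
the set of positive integers `k` expressible as `k = n₁² + d n₂² + n₃^r` with `n₁, n₂, n₃ ∈ ℤ`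
has natural density `1`. -/
theorem sums_of_squares_and_powers_density_one
    (d : ℕ)
    (hd : d ∈ ({3, 7, 11, 15, 19, 35, 43, 51, 67, 91, 115, 123, 163, 187, 235, 267, 403, 427} :
      Finset ℕ))
    (r : ℕ) (hr : r.Prime) (hr3 : 3 ≤ r)
    (hp : ∀ p : ℕ, p.Prime → p ∣ d → ¬ p ≡ 1 [MOD r]) :
    Tendsto (fun N : ℕ =>
        ({k : ℕ | 1 ≤ k ∧ k ≤ N ∧
            ∃ n₁ n₂ n₃ : ℤ, (k : ℤ) = n₁ ^ 2 + d * n₂ ^ 2 + n₃ ^ r}.ncard : ℝ) / N)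
      atTop (nhds 1) := by
  have hodd : Odd d := by
    revert hd
    clear hp
    revert d
    decide
  have hp' : ∀ p : ℕ, p.Prime → p ∣ d → ¬ r ∣ p - 1 := fun p hpp hpd hdvd =>
    hp p hpp hpd ((Nat.modEq_iff_dvd' hpp.one_le).2 hdvd).symm
  refine tendsto_ncard_div_of_windows (Q := fun k => IsRepresented d r k) fun ε hε => ?_
  obtain ⟨κ, hκ⟩ := exists_nat_gt (22 / ε)
  obtain ⟨n₀, hn₀⟩ := exists_sparse_window hodd hr hr3 hp' (κ + 6) (Nat.le_add_left 6 κ)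
  refine ⟨n₀, fun n hn => ?_⟩
  obtain ⟨lo, hlo, hcard⟩ := hn₀ n hn
  refine ⟨lo, hlo, hcard.trans (mul_le_mul_of_nonneg_right ?_ ?_)⟩
  · rw [div_lt_iff₀ hε] at hκ
    push_cast
    rw [div_le_iff₀ (by positivity)]
    linarith
  · exact sub_nonneg.2 (by exact_mod_cast hlo.le)
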